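/- arXiv:1404.3000 — 3 statements merged into one kernel-verified Lean document; each statement's English description precedes it below -/
import Mathlib

section
/- Let P be an n-dimensional polytope, let Q be a proper (possibly empty) face of P, and let S be a polyhedral subdivision of P. Then the alternating sum of (-1)^{dim F} over all cells F of S that are disjoint from Q and whose relative interior is contained in the interior of P equals (-1)^n if Q is empty, and 0 otherwise. -/
open Classical Polynomial
noncomputable section

abbrev Euc (n : ℕ) := Fin n → ℝ

def IsPolytope {n : ℕ} (P : Set (Euc n)) : Prop :=
  ∃ V : Finset (Euc n), P = convexHull ℝ (V : Set (Euc n))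

def pdim {n : ℕ} (P : Set (Euc n)) : ℕ := Module.finrank ℝ (vectorSpan ℝ P)

structure Subdivision {n : ℕ} (P : Set (Euc n)) where
  cells : Finset (Set (Euc n))
  nonempty_cells : ∀ F ∈ cells, (F : Set (Euc n)).Nonempty
  poly : ∀ F ∈ cells, IsPolytope F
  cover : (⋃ F ∈ cells, F) = P
  inter_face : ∀ F ∈ cells, ∀ G ∈ cells, IsExposed ℝ F (F ∩ G) ∧ IsExposed ℝ G (F ∩ G)
  face_mem : ∀ F ∈ cells, ∀ G : Set (Euc n), IsExposed ℝ F G → G.Nonempty → G ∈ cells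

structure RO {n : ℕ} (C : Set (Euc n)) : Prop where
  cvx : Convex ℝ C
  ne : C.Nonempty
  rel : ∀ x ∈ C, ∀ y ∈ C, ∃ ε : ℝ, 0 < ε ∧ x + ε • (x - y) ∈ C
  bdd : Bornology.IsBounded C

inductive Good {n : ℕ} (C : Set (Euc n)) : ℤ → Prop
  | ro : RO C → Good C ((-1) ^ pdim C)
  | cpt : Convex ℝ C → IsCompact C → C.Nonempty → Good C 1

lemma shrink {n : ℕ} {C : Set (Euc n)} (hC : Convex ℝ C) {x v : Euc n} (hx : x ∈ C) {δ s : ℝ}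
    (h : x + δ • v ∈ C) (hs : 0 ≤ s) (hsd : s ≤ δ) : x + s • v ∈ C := by
  rcases hs.eq_or_lt with rfl | hs
  · simpa using hx
  have hd : 0 < δ := lt_of_lt_of_le hs hsd
  have := hC.add_smul_mem hx h (t := s / δ) ⟨by positivity, by rw [div_le_one hd]; exact hsd⟩
  rwa [smul_smul, div_mul_cancel₀ _ hd.ne'] at this

lemma ro_dir {n : ℕ} {C : Set (Euc n)} (hC : RO C) {x v : Euc n} (hx : x ∈ C)
    (hv : v ∈ vectorSpan ℝ C) : ∃ δ : ℝ, 0 < δ ∧ x + δ • v ∈ C := by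
  rw [vectorSpan_eq_span_vsub_set_right ℝ hx] at hv
  induction hv using Submodule.span_induction with
  | mem y hy =>
    obtain ⟨z, hz, rfl⟩ := hy
    exact ⟨1, one_pos, by simpa using hz⟩
  | zero => exact ⟨1, one_pos, by simpa using hx⟩
  | add y z _ _ h1 h2 =>
    obtain ⟨d1, hd1, h1⟩ := h1
    obtain ⟨d2, hd2, h2⟩ := h2
    have hm : 0 < min d1 d2 := lt_min hd1 hd2
    have k1 := shrink hC.cvx hx h1 hm.le (min_le_left _ _)
    have k2 := shrink hC.cvx hx h2 hm.le (min_le_right _ _)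
    refine ⟨min d1 d2 / 2, by positivity, ?_⟩
    have := hC.cvx k1 k2 (a := 1/2) (b := 1/2) (by norm_num) (by norm_num) (by norm_num)
    convert this using 1
    module
  | smul c y _ h =>
    obtain ⟨d, hd, h⟩ := h
    rcases lt_trichotomy c 0 with hc | rfl | hc
    · obtain ⟨ε, hε, h'⟩ := hC.rel x hx _ h
      refine ⟨ε * d / (-c), div_pos (by positivity) (by linarith), ?_⟩
      convert h' using 1
      rw [smul_smul, show ε * d / (-c) * c = - (ε * d) by have := hc.ne; field_simp]
      module
    · exact ⟨1, one_pos, by simpa using hx⟩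
    · refine ⟨d / c, by positivity, ?_⟩
      rwa [smul_smul, div_mul_cancel₀ _ hc.ne']

lemma ro_dir' {n : ℕ} {C B : Set (Euc n)} (hC : RO C) (hB : IsOpen B) {x v : Euc n} (hx : x ∈ C)
    (hxB : x ∈ B)
    (hv : v ∈ vectorSpan ℝ C) : ∃ δ : ℝ, 0 < δ ∧ x + δ • v ∈ C ∩ B := by
  obtain ⟨d, hd, h⟩ := ro_dir hC hx hv
  have hc : Filter.Tendsto (fun s : ℝ => x + s • v) (nhdsWithin 0 (Set.Ioi 0)) (nhds x) := by
    have : ContinuousAt (fun s : ℝ => x + s • v) 0 := by fun_prop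
    have h2 := this.tendsto
    simp only [zero_smul, add_zero] at h2
    exact h2.mono_left nhdsWithin_le_nhds
  have h1 := hc.eventually (hB.mem_nhds hxB)
  have h2 : ∀ᶠ s in nhdsWithin (0:ℝ) (Set.Ioi 0), s ∈ Set.Ioo 0 d := Ioo_mem_nhdsGT hd
  obtain ⟨s, hs, hs'⟩ := (h1.and h2).exists
  exact ⟨s, hs'.1, shrink hC.cvx hx h hs'.1.le hs'.2.le, hs⟩

lemma ro_inter {n : ℕ} {C B : Set (Euc n)} (hC : RO C) (hB : IsOpen B) (hBc : Convex ℝ B)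
    (hne : (C ∩ B).Nonempty) : RO (C ∩ B) ∧ pdim (C ∩ B) = pdim C := by
  constructor
  · refine ⟨hC.cvx.inter hBc, hne, ?_, hC.bdd.subset Set.inter_subset_left⟩
    intro x hx y hy
    exact ro_dir' hC hB hx.1 hx.2 (vsub_mem_vectorSpan ℝ hx.1 hy.1)
  · unfold pdim
    have : vectorSpan ℝ (C ∩ B) = vectorSpan ℝ C := by
      apply le_antisymm (vectorSpan_mono ℝ Set.inter_subset_left)
      intro v hv
      obtain ⟨x, hx⟩ := hne
      obtain ⟨d, hd, h⟩ := ro_dir' hC hB hx.1 hx.2 hv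
      have := vsub_mem_vectorSpan ℝ h hx
      simp only [vsub_eq_sub, add_sub_cancel_left] at this
      exact (Submodule.smul_mem_iff _ hd.ne').1 this
    rw [this]

lemma ro_slice {n : ℕ} {C : Set (Euc n)} (hC : RO C) (l : Euc n →ₗ[ℝ] ℝ) (t : ℝ)
    (hne : (C ∩ l ⁻¹' {t}).Nonempty) : RO (C ∩ l ⁻¹' {t}) ∧
      vectorSpan ℝ (C ∩ l ⁻¹' {t}) = vectorSpan ℝ C ⊓ LinearMap.ker l := by
  constructor
  · refine ⟨hC.cvx.inter ((convex_singleton t).linear_preimage l), hne, ?_, hC.bdd.subset Set.inter_subset_left⟩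
    rintro x ⟨hx, hx'⟩ y ⟨hy, hy'⟩
    obtain ⟨ε, h, h'⟩ := hC.rel x hx y hy
    refine ⟨ε, h, h', ?_⟩
    simp only [Set.mem_preimage, Set.mem_singleton_iff] at hx' hy' ⊢
    simp [hx', hy']
  · apply le_antisymm
    · apply le_inf (vectorSpan_mono ℝ Set.inter_subset_left)
      unfold vectorSpan
      rw [Submodule.span_le]
      rintro _ ⟨x, hx, y, hy, rfl⟩
      have hx' := hx.2
      have hy' := hy.2
      simp only [Set.mem_preimage, Set.mem_singleton_iff] at hx' hy'
      simp [hx', hy']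
    · rintro v ⟨hv, hv'⟩
      obtain ⟨x, hx⟩ := hne
      obtain ⟨d, hd, h⟩ := ro_dir hC hx.1 hv
      have h2 : x + d • v ∈ C ∩ l ⁻¹' {t} := by
        refine ⟨h, ?_⟩
        have hx' := hx.2
        simp only [SetLike.mem_coe, LinearMap.mem_ker] at hv'
        simp only [Set.mem_preimage, Set.mem_singleton_iff] at hx' ⊢
        simp [hx', hv']
      have := vsub_mem_vectorSpan ℝ h2 hx
      simp only [vsub_eq_sub, add_sub_cancel_left] at this
      exact (Submodule.smul_mem_iff _ hd.ne').1 this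

lemma finrank_inf_ker {n : ℕ} (W : Submodule ℝ (Euc n)) (l : Euc n →ₗ[ℝ] ℝ) (h : ¬ W ≤ LinearMap.ker l) :
    Module.finrank ℝ W = Module.finrank ℝ (W ⊓ LinearMap.ker l : Submodule ℝ (Euc n)) + 1 := by
  have h0 : l.domRestrict W ≠ 0 := by
    intro h0
    apply h
    intro w hw
    exact LinearMap.congr_fun h0 ⟨w, hw⟩
  have h1 := Module.Dual.finrank_ker_add_one_of_ne_zero (f := (l.domRestrict W : Module.Dual ℝ W)) h0
  rw [← h1, LinearMap.ker_domRestrict]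
  congr 1
  rw [← Submodule.finrank_map_subtype_eq W, Submodule.map_comap_subtype]

lemma ev_Ioo (p q t : ℝ) (hpq : p < q) : ∀ᶠ s in nhdsWithin t (Set.Ioi t),
    ((if t ∈ Set.Ioo p q then 1 else 0) - (if s ∈ Set.Ioo p q then 1 else 0) : ℤ) =
      if t = p then -1 else 0 := by
  have key : ∀ m, t < m → ∀ᶠ s in nhdsWithin t (Set.Ioi t), s ∈ Set.Ioo t m :=
    fun m hm => Ioo_mem_nhdsGT hm
  rcases lt_or_ge t p with h | h
  · filter_upwards [key p h] with s hs
    simp [hs.2.not_gt, h.not_gt, h.ne]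
  rcases lt_or_ge t q with h2 | h2
  · filter_upwards [key q h2] with s hs
    have : p < s := h.trans_lt hs.1
    rcases h.eq_or_lt with rfl | h
    · simp [this, hs.2]
    · simp [this, hs.2, h, h2, h.ne']
  · filter_upwards [key (t+1) (by linarith)] with s hs
    have : ¬ s < q := by linarith [hs.1]
    simp [this, h2.not_gt, (hpq.trans_le h2).ne']

lemma ev_Icc (p q t : ℝ) (hpq : p ≤ q) : ∀ᶠ s in nhdsWithin t (Set.Ioi t),
    ((if t ∈ Set.Icc p q then 1 else 0) - (if s ∈ Set.Icc p q then 1 else 0) : ℤ) =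
      if t = q then 1 else 0 := by
  have key : ∀ m, t < m → ∀ᶠ s in nhdsWithin t (Set.Ioi t), s ∈ Set.Ioo t m :=
    fun m hm => Ioo_mem_nhdsGT hm
  rcases lt_or_ge t p with h | h
  · filter_upwards [key p h] with s hs
    simp [hs.2.not_ge, h.not_ge, (h.trans_le hpq).ne]
  rcases lt_or_ge t q with h2 | h2
  · filter_upwards [key q h2] with s hs
    have : p ≤ s := (h.trans_lt hs.1).le
    simp [this, hs.2.le, h, h2.le, h2.ne]
  · filter_upwards [key (t+1) (by linarith)] with s hs
    have : ¬ s ≤ q := by linarith [hs.1]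
    rcases h2.eq_or_lt with rfl | h2
    · simp [this, hpq]
    · simp [this, h2.not_ge, h2.ne']

lemma good_slice {n : ℕ} {C : Set (Euc n)} {v : ℤ} (hC : Good C v) (l : Euc n →ₗ[ℝ] ℝ) :
    ∃ (r : ℝ) (e w : ℤ), v = w * e ∧ (∀ t ∈ l '' C, Good (C ∩ l ⁻¹' {t}) w) ∧
      ∀ t, ∀ᶠ s in nhdsWithin t (Set.Ioi t),
        ((if t ∈ l '' C then 1 else 0) - (if s ∈ l '' C then 1 else 0) : ℤ) =
          if t = r then e else 0 := by
  have hlc : Continuous l := l.continuous_of_finiteDimensional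
  have hsl : ∀ t ∈ l '' C, (C ∩ l ⁻¹' {t}).Nonempty := by
    rintro _ ⟨x, hx, rfl⟩
    exact ⟨x, hx, rfl⟩
  cases hC with
  | cpt h1 h2 h3 =>
    have hi := eq_Icc_of_connected_compact ((h1.linear_image l).isConnected (h3.image l))
      (h2.image hlc)
    have hle : sInf (l '' C) ≤ sSup (l '' C) := by
      have := h3.image l
      rw [hi] at this
      exact Set.nonempty_Icc.1 this
    refine ⟨sSup (l '' C), 1, 1, by simp, ?_, ?_⟩
    · intro t ht
      exact Good.cpt (h1.inter ((convex_singleton t).linear_preimage l))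
        (h2.inter_right (isClosed_singleton.preimage hlc)) (hsl t ht)
    · intro t
      have := ev_Icc _ _ t hle
      simpa only [← hi] using this
  | ro h =>
    by_cases hk : vectorSpan ℝ C ≤ LinearMap.ker l
    · obtain ⟨x, hx⟩ := h.ne
      have hconst : ∀ y ∈ C, l y = l x := by
        intro y hy
        have := hk (vsub_mem_vectorSpan ℝ hy hx)
        simpa [sub_eq_zero] using this
      have hi : l '' C = Set.Icc (l x) (l x) := by
        rw [Set.Icc_self]
        ext t
        constructor
        · rintro ⟨y, hy, rfl⟩
          exact hconst y hy
        · rintro rfl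
          exact ⟨x, hx, rfl⟩
      refine ⟨l x, 1, (-1) ^ pdim C, by simp, ?_, ?_⟩
      · intro t ht
        rw [hi, Set.Icc_self] at ht
        rw [Set.mem_singleton_iff] at ht
        have : C ∩ l ⁻¹' {t} = C := by
          rw [Set.inter_eq_left]
          intro y hy
          simp [hconst y hy, ht]
        rw [this]
        exact Good.ro h
      · intro t
        have := ev_Icc _ _ t (le_refl (l x))
        simpa only [← hi] using this
    · set J := l '' C with hJ
      have hJb : Bornology.IsBounded J := by
        have := (LinearMap.toContinuousLinearMap l).lipschitz.isBounded_image h.bdd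
        simpa using this
      have hJc : Convex ℝ J := h.cvx.linear_image l
      have hJrel : ∀ x ∈ J, ∀ y ∈ J, ∃ ε : ℝ, 0 < ε ∧ x + ε * (x - y) ∈ J := by
        rintro _ ⟨x, hx, rfl⟩ _ ⟨y, hy, rfl⟩
        obtain ⟨ε, h1, h2⟩ := h.rel x hx y hy
        exact ⟨ε, h1, _, h2, by simp⟩
      have hJn : ∃ x ∈ J, ∃ y ∈ J, x < y := by
        by_contra hcon
        push Not at hcon
        apply hk
        unfold vectorSpan
        rw [Submodule.span_le]
        rintro _ ⟨x, hx, y, hy, rfl⟩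
        have a1 := hcon _ ⟨x, hx, rfl⟩ _ ⟨y, hy, rfl⟩
        have a2 := hcon _ ⟨y, hy, rfl⟩ _ ⟨x, hx, rfl⟩
        simp [le_antisymm a2 a1]
      obtain ⟨x, hx, y, hy, hxy⟩ := hJn
      have hi : J = Set.Ioo (sInf J) (sSup J) := by
        ext t
        constructor
        · intro ht
          have b1 : ∃ z ∈ J, z < t := by
            rcases lt_or_ge x t with h1 | h1
            · exact ⟨x, hx, h1⟩
            obtain ⟨ε, h2, h3⟩ := hJrel t ht y hy
            exact ⟨_, h3, by nlinarith⟩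
          have b2 : ∃ z ∈ J, t < z := by
            rcases lt_or_ge t y with h1 | h1
            · exact ⟨y, hy, h1⟩
            obtain ⟨ε, h2, h3⟩ := hJrel t ht x hx
            exact ⟨_, h3, by nlinarith⟩
          obtain ⟨z, hz, hz'⟩ := b1
          obtain ⟨u, hu, hu'⟩ := b2
          exact ⟨(csInf_le hJb.bddBelow hz).trans_lt hz', hu'.trans_le (le_csSup hJb.bddAbove hu)⟩
        · rintro ⟨h1, h2⟩
          obtain ⟨z, hz, hz'⟩ := exists_lt_of_csInf_lt ⟨x, hx⟩ h1
          obtain ⟨u, hu, hu'⟩ := exists_lt_of_lt_csSup ⟨x, hx⟩ h2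
          exact hJc.ordConnected.out hz hu ⟨hz'.le, hu'.le⟩
      have hlt : sInf J < sSup J :=
        (csInf_le hJb.bddBelow hx).trans_lt (hxy.trans_le (le_csSup hJb.bddAbove hy))
      refine ⟨sInf J, -1, (-1) ^ (Module.finrank ℝ (vectorSpan ℝ C ⊓ LinearMap.ker l : Submodule ℝ (Euc n))), ?_, ?_, ?_⟩
      · unfold pdim
        rw [finrank_inf_ker _ l hk, pow_succ]
      · intro t ht
        obtain ⟨g1, g2⟩ := ro_slice h l t (hsl t ht)
        rw [← g2]
        exact Good.ro g1
      · intro t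
        have := ev_Ioo _ _ t hlt
        simpa only [← hi] using this

lemma key {n : ℕ} {ι : Type*} (k : ℕ) : ∀ (W : Submodule ℝ (Euc n)), Module.finrank ℝ W = k →
    ∀ (s : Finset ι) (C : ι → Set (Euc n)) (v a : ι → ℤ), (∀ i ∈ s, Good (C i) (v i)) →
    (∀ i ∈ s, ∀ j ∈ s, ∀ x ∈ C i, ∀ y ∈ C j, x - y ∈ W) →
    (∀ x, ∑ i ∈ s, (if x ∈ C i then a i else 0) = 0) → ∑ i ∈ s, a i * v i = 0 := by
  induction k using Nat.strong_induction_on with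
  | _ k ih =>
  intro W hW s C v a hG hCW hsum
  by_cases hb : W = ⊥
  · subst hb
    rcases s.eq_empty_or_nonempty with rfl | ⟨i0, hi0⟩
    · simp
    have hne : ∀ i ∈ s, (C i).Nonempty := by
      intro i hi
      have h1 := hG i hi
      generalize v i = z at h1
      cases h1 with
      | ro h => exact h.ne
      | cpt _ _ h => exact h
    obtain ⟨x, hx⟩ := hne i0 hi0
    have hCx : ∀ i ∈ s, C i = {x} := by
      intro i hi
      apply (Set.Nonempty.subset_singleton_iff (hne i hi)).1
      intro y hy
      have := hCW i hi i0 hi0 y hy x hx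
      simpa [sub_eq_zero] using this
    have hv : ∀ i ∈ s, v i = 1 := by
      intro i hi
      have h1 := hG i hi
      rw [hCx i hi] at h1
      generalize v i = z at h1
      cases h1 with
      | ro h => rw [pdim, vectorSpan_singleton, finrank_bot, pow_zero]
      | cpt _ _ h => rfl
    rw [← hsum x]
    apply Finset.sum_congr rfl
    intro i hi
    rw [hv i hi, hCx i hi]
    simp
  · obtain ⟨u, hu, hu0⟩ := (Submodule.ne_bot_iff W).1 hb
    obtain ⟨l, hl⟩ : ∃ l : Euc n →ₗ[ℝ] ℝ, l u ≠ 0 := by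
      obtain ⟨j, hj⟩ := Function.ne_iff.1 hu0
      exact ⟨LinearMap.proj j, hj⟩
    have hk : ¬ W ≤ LinearMap.ker l := fun h => hl (h hu)
    have hfr := finrank_inf_ker W l hk
    choose! r e w hv hsl hev using fun i (hi : i ∈ s) => good_slice (hG i hi) l
    have hs : ∀ t : ℝ, ∑ i ∈ s, a i * w i * (if t ∈ l '' C i then 1 else 0) = 0 := by
      intro t
      have := ih _ (by omega) (W ⊓ LinearMap.ker l) rfl (s.filter fun i => t ∈ l '' C i)
        (fun i => C i ∩ l ⁻¹' {t}) w a ?_ ?_ ?_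
      · rw [Finset.sum_filter] at this
        refine Eq.trans ?_ this
        apply Finset.sum_congr rfl
        intro i _
        split_ifs <;> simp
      · intro i hi
        rw [Finset.mem_filter] at hi
        exact hsl i hi.1 t hi.2
      · intro i hi j hj x hx y hy
        rw [Finset.mem_filter] at hi hj
        refine ⟨hCW i hi.1 j hj.1 x hx.1 y hy.1, ?_⟩
        have hx' := hx.2
        have hy' := hy.2
        simp only [Set.mem_preimage, Set.mem_singleton_iff] at hx' hy'
        simp [hx', hy']
      · intro x
        rw [Finset.sum_filter]
        by_cases hx : l x = t
        · refine Eq.trans ?_ (hsum x)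
          apply Finset.sum_congr rfl
          intro i _
          by_cases hxi : x ∈ C i
          · have : t ∈ l '' C i := ⟨x, hxi, hx⟩
            rw [if_pos this, if_pos hxi, if_pos ⟨hxi, hx⟩]
          · rw [if_neg hxi, if_neg (fun h : x ∈ C i ∩ l ⁻¹' {t} => hxi h.1), ite_self]
        · apply Finset.sum_eq_zero
          intro i _
          rw [if_neg (fun h : x ∈ C i ∩ l ⁻¹' {t} => hx h.2), ite_self]
    have hs2 : ∀ t : ℝ, ∑ i ∈ s, (if t = r i then a i * v i else 0) = 0 := by
      intro t
      have h1 := (Finset.eventually_all s).2 (fun i hi => hev i hi t)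
      obtain ⟨t', ht'⟩ := h1.exists
      have h2 := hs t
      have h3 := hs t'
      have h4 : ∑ i ∈ s, a i * w i * ((if t ∈ l '' C i then 1 else 0) - (if t' ∈ l '' C i then 1 else 0)) = 0 := by
        simp only [mul_sub, Finset.sum_sub_distrib]
        rw [h2, h3, sub_zero]
      refine Eq.trans ?_ h4
      apply Finset.sum_congr rfl
      intro i hi
      rw [ht' i hi, hv i hi]
      split_ifs <;> ring
    rw [← Finset.sum_fiberwise_of_maps_to (s := s) (t := s.image r) (g := r)
      (fun i hi => Finset.mem_image_of_mem r hi)]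
    apply Finset.sum_eq_zero
    intro t _
    rw [Finset.sum_filter]
    refine Eq.trans ?_ (hs2 t)
    apply Finset.sum_congr rfl
    intro i _
    simp only [eq_comm]

lemma key2 {n : ℕ} {ι : Type*} (s : Finset ι) (C : ι → Set (Euc n)) (K : Set (Euc n)) (v : ℤ)
    (hK : Good K v) (hC : ∀ i ∈ s, RO (C i)) (hsub : ∀ i ∈ s, C i ⊆ K)
    (hu : ∀ x ∈ K, ∃ i ∈ s, x ∈ C i)
    (hd : ∀ i ∈ s, ∀ j ∈ s, ∀ x ∈ C i, x ∈ C j → i = j) :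
    ∑ i ∈ s, (-1 : ℤ) ^ pdim (C i) = v := by
  have := key (n := n) _ ⊤ rfl (Finset.insertNone s) (fun o => o.elim K C)
    (fun o => o.elim v fun i => (-1 : ℤ) ^ pdim (C i)) (fun o => o.elim (-1) fun _ => 1) ?_ ?_ ?_
  · rw [Finset.sum_insertNone] at this
    simp at this
    linarith
  · intro o ho
    cases o with
    | none => exact hK
    | some i => exact Good.ro (hC i (by simpa using ho))
  · intros; trivial
  · intro x
    rw [Finset.sum_insertNone]
    simp only [Option.elim]
    by_cases hx : x ∈ K
    · obtain ⟨i, hi, hxi⟩ := hu x hx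
      rw [Finset.sum_eq_single i]
      · simp [hx, hxi]
      · intro j hj hji
        apply if_neg
        intro hxj
        exact hji (hd j hj i hi x hxj hxi)
      · intro h; exact absurd hi h
    · rw [Finset.sum_eq_zero]
      · simp [hx]
      · intro i hi
        exact if_neg (fun h => hx (hsub i hi h))

def RI {n : ℕ} (F : Set (Euc n)) : Set (Euc n) :=
  {x | x ∈ F ∧ ∀ y ∈ F, ∃ ε : ℝ, 0 < ε ∧ x + ε • (x - y) ∈ F}

lemma RI_seg {n : ℕ} {F : Set (Euc n)} (hF : Convex ℝ F) {x u : Euc n} (hx : x ∈ RI F) (hu : u ∈ F)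
    {s : ℝ} (hs : 0 ≤ s) (hs1 : s < 1) : x + s • (u - x) ∈ RI F := by
  refine ⟨hF.add_smul_sub_mem hx.1 hu ⟨hs, hs1.le⟩, ?_⟩
  intro y hy
  obtain ⟨ε, hε, h⟩ := hx.2 y hy
  have hD : 0 < 1 + ε * s := by positivity
  refine ⟨(1 - s) * ε / (1 + ε * s), div_pos (mul_pos (by linarith) hε) hD, ?_⟩
  have := hF h hu (a := (1 - s) / (1 + ε * s)) (b := s * (1 + ε) / (1 + ε * s))
    (div_nonneg (by linarith) hD.le) (by positivity) (by field_simp; ring)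
  convert this using 1
  ext j
  simp only [Pi.add_apply, Pi.smul_apply, Pi.sub_apply, smul_eq_mul]
  field_simp
  ring

lemma intrinsic_subset_RI {n : ℕ} {F : Set (Euc n)} : intrinsicInterior ℝ F ⊆ RI F := by
  intro x hx
  refine ⟨intrinsicInterior_subset hx, ?_⟩
  intro y hy
  rw [mem_intrinsicInterior] at hx
  obtain ⟨z, hz, rfl⟩ := hx
  have hmem : ∀ s : ℝ, (z : Euc n) + s • ((z : Euc n) - y) ∈ affineSpan ℝ F := by
    intro s
    have := AffineMap.lineMap_mem (s + 1) (subset_affineSpan ℝ F hy) z.2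
    convert this using 1
    rw [AffineMap.lineMap_apply_module]
    module
  have hc : ContinuousAt (fun s : ℝ => (⟨_, hmem s⟩ : affineSpan ℝ F)) 0 := by
    apply Continuous.continuousAt
    apply Continuous.subtype_mk
    fun_prop
  have h0 : (fun s : ℝ => (⟨_, hmem s⟩ : affineSpan ℝ F)) 0 = z := by
    ext1
    simp
  have h1 := hc.tendsto
  beta_reduce at h0
  rw [h0] at h1
  have h2 := (h1.mono_left (nhdsWithin_le_nhds (s := Set.Ioi 0))).eventually
    (isOpen_interior.mem_nhds hz)
  have h3 : ∀ᶠ s in nhdsWithin (0:ℝ) (Set.Ioi 0), s ∈ Set.Ioi (0:ℝ) := self_mem_nhdsWithin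
  obtain ⟨s, hs, hs'⟩ := (h2.and h3).exists
  exact ⟨s, hs', (interior_subset (s := ((↑) ⁻¹' F : Set (affineSpan ℝ F)))) hs⟩

lemma RI_nonempty {n : ℕ} {F : Set (Euc n)} (hF : Convex ℝ F) (hne : F.Nonempty) : (RI F).Nonempty :=
  (hne.intrinsicInterior hF).mono intrinsic_subset_RI

lemma RI_ro {n : ℕ} {F : Set (Euc n)} (hF : Convex ℝ F) (hne : F.Nonempty) (hb : Bornology.IsBounded F) :
    RO (RI F) ∧ pdim (RI F) = pdim F := by
  have hsub : RI F ⊆ F := fun x hx => hx.1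
  constructor
  · refine ⟨?_, RI_nonempty hF hne, ?_, hb.subset hsub⟩
    · rw [convex_iff_forall_pos]
      intro x hx y hy a b ha hb hab
      have := RI_seg hF hx hy.1 hb.le (by linarith)
      convert this using 1
      rw [← eq_sub_iff_add_eq] at hab
      subst hab
      module
    · intro x hx y hy
      obtain ⟨ε, h, h'⟩ := hx.2 y hy.1
      refine ⟨ε / 2, by positivity, ?_⟩
      convert RI_seg hF hx h' (s := 1/2) (by norm_num) (by norm_num) using 1
      module
  · have : vectorSpan ℝ (RI F) = vectorSpan ℝ F := by
      apply le_antisymm (vectorSpan_mono ℝ hsub)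
      obtain ⟨x, hx⟩ := RI_nonempty hF hne
      rw [vectorSpan_eq_span_vsub_set_right ℝ hx.1, Submodule.span_le]
      rintro _ ⟨y, hy, rfl⟩
      have h1 := vsub_mem_vectorSpan ℝ (RI_seg hF hx hy (s := 1/2) (by norm_num) (by norm_num)) hx
      simp only [vsub_eq_sub, add_sub_cancel_left] at h1
      exact (Submodule.smul_mem_iff _ (by norm_num)).1 h1
    rw [pdim, pdim, this]

lemma RI_dense {n : ℕ} {F B : Set (Euc n)} (hF : Convex ℝ F) (hB : IsOpen B)
    (hne : (F ∩ B).Nonempty) : (RI F ∩ B).Nonempty := by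
  obtain ⟨u, hu, huB⟩ := hne
  obtain ⟨x, hx⟩ := RI_nonempty hF ⟨u, hu⟩
  have hc : Filter.Tendsto (fun s : ℝ => x + s • (u - x)) (nhdsWithin 1 (Set.Iio 1)) (nhds u) := by
    have : ContinuousAt (fun s : ℝ => x + s • (u - x)) 1 := by fun_prop
    have h2 := this.tendsto
    simp only [one_smul, add_sub_cancel] at h2
    exact h2.mono_left nhdsWithin_le_nhds
  have h1 := hc.eventually (hB.mem_nhds huB)
  have h2 : ∀ᶠ s in nhdsWithin (1:ℝ) (Set.Iio 1), s ∈ Set.Ioo (0:ℝ) 1 := Ioo_mem_nhdsLT one_pos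
  obtain ⟨s, hs, hs'⟩ := (h1.and h2).exists
  exact ⟨_, RI_seg hF hx hu hs'.1.le hs'.2, hs⟩

lemma span_top {n : ℕ} {F : Set (Euc n)} (hF : Convex ℝ F) (hne : F.Nonempty)
    (h : vectorSpan ℝ F = ⊤) : (interior F).Nonempty := by
  rw [hF.interior_nonempty_iff_affineSpan_eq_top]
  rwa [AffineSubspace.affineSpan_eq_top_iff_vectorSpan_eq_top_of_nonempty ℝ _ _ hne]

lemma RI_full {n : ℕ} {F : Set (Euc n)} (hF : Convex ℝ F) (hne : F.Nonempty)
    (h : vectorSpan ℝ F = ⊤) : intrinsicInterior ℝ F = RI F := by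
  apply Set.Subset.antisymm intrinsic_subset_RI
  intro x hx
  apply interior_subset_intrinsicInterior
  obtain ⟨z, hz⟩ := span_top hF hne h
  obtain ⟨ε, hε, h'⟩ := hx.2 z (interior_subset hz)
  apply hF.openSegment_interior_closure_subset_interior hz (subset_closure h')
  refine ⟨ε / (1 + ε), 1 / (1 + ε), by positivity, by positivity, by field_simp; ring, ?_⟩
  ext j
  simp only [Pi.add_apply, Pi.smul_apply, Pi.sub_apply, smul_eq_mul]
  field_simp
  ring

open Pointwise in
lemma support {n : ℕ} {F : Set (Euc n)} (hF : Convex ℝ F) {x : Euc n} (hx : x ∈ F) (hxR : x ∉ RI F) :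
    ∃ l : StrongDual ℝ (Euc n), (∀ y ∈ F, l y ≤ l x) ∧ ∃ y ∈ F, l y < l x := by
  obtain ⟨W', hW'⟩ := Submodule.exists_isCompl (vectorSpan ℝ F)
  set T : Set (Euc n) := F + (W' : Set (Euc n)) with hT
  have hTc : Convex ℝ T := hF.add W'.convex
  have hFT : F ⊆ T := fun y hy => ⟨y, hy, 0, W'.zero_mem, add_zero y⟩
  have hTs : vectorSpan ℝ T = ⊤ := by
    rw [eq_top_iff, ← hW'.sup_eq_top]
    apply sup_le (vectorSpan_mono ℝ hFT)
    intro w hw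
    have : x + w ∈ T := ⟨x, hx, w, hw, rfl⟩
    have := vsub_mem_vectorSpan ℝ this (hFT hx)
    simpa using this
  have hTi := span_top hTc ⟨x, hFT hx⟩ hTs
  have hxi : x ∉ interior T := by
    intro hxi
    apply hxR
    refine ⟨hx, fun y hy => ?_⟩
    obtain ⟨ε, hε, f, hf, w, hw, hfw⟩ := (intrinsic_subset_RI (interior_subset_intrinsicInterior hxi)).2 y (hFT hy)
    refine ⟨ε, hε, ?_⟩
    simp only at hfw
    have hw2 : w ∈ vectorSpan ℝ F := by
      have : w = (x - f) + ε • (x - y) := by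
        rw [← add_right_inj f, hfw]; abel
      rw [this]
      exact Submodule.add_mem _ (vsub_mem_vectorSpan ℝ hx hf)
        (Submodule.smul_mem _ _ (vsub_mem_vectorSpan ℝ hx hy))
    have : w = 0 := by
      have := hW'.disjoint.le_bot ⟨hw2, hw⟩
      simpa using this
    rw [← hfw, this, add_zero]
    exact hf
  obtain ⟨l, hl⟩ := geometric_hahn_banach_open_point hTc.interior isOpen_interior hxi
  have hle : ∀ y ∈ T, l y ≤ l x := by
    intro y hy
    have h1 : y ∈ closure (interior T) := by
      rw [hTc.closure_interior_eq_closure_of_nonempty_interior hTi]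
      exact subset_closure hy
    have h2 : closure (interior T) ⊆ {y | l y ≤ l x} :=
      closure_minimal (fun z hz => (hl z hz).le) (isClosed_le l.continuous continuous_const)
    exact h2 h1
  refine ⟨l, fun y hy => hle y (hFT hy), ?_⟩
  have hW0 : ∀ w ∈ W', l w = 0 := by
    intro w hw
    have h1 := hle (x + w) ⟨x, hx, w, hw, rfl⟩
    have h2 := hle (x + -w) ⟨x, hx, -w, W'.neg_mem hw, rfl⟩
    simp only [map_add, map_neg] at h1 h2
    linarith
  obtain ⟨z, hz⟩ := hTi
  have hlz := hl z hz
  obtain ⟨f, hf, w, hw, rfl⟩ := interior_subset hz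
  simp only [map_add, hW0 w hw, add_zero] at hlz
  exact ⟨f, hf, hlz⟩

lemma RI_const {n : ℕ} {F : Set (Euc n)} {x : Euc n} (hx : x ∈ RI F) (l : StrongDual ℝ (Euc n))
    (h : ∀ y ∈ F, l y ≤ l x) : ∀ y ∈ F, l y = l x := by
  intro y hy
  obtain ⟨ε, hε, h'⟩ := hx.2 y hy
  have h1 := h _ h'
  have h2 := h y hy
  simp only [map_add, map_smul, map_sub, smul_eq_mul] at h1
  nlinarith

lemma face_full {n : ℕ} {F G : Set (Euc n)} {x : Euc n} (hG : IsExposed ℝ F G) (hx : x ∈ RI F)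
    (hxG : x ∈ G) : F ⊆ G := by
  obtain ⟨l, hl⟩ := hG ⟨x, hxG⟩
  rw [hl] at hxG ⊢
  intro y hy
  refine ⟨hy, fun z hz => ?_⟩
  rw [RI_const hx l hxG.2 y hy]
  exact hxG.2 z hz

lemma RI_face {n : ℕ} {F P Q : Set (Euc n)} {x : Euc n} (hFP : F ⊆ P) (hQ : IsExposed ℝ P Q)
    (hx : x ∈ RI F) (hxQ : x ∈ Q) : F ⊆ Q := by
  obtain ⟨l, hl⟩ := hQ ⟨x, hxQ⟩
  rw [hl] at hxQ ⊢
  intro y hy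
  refine ⟨hFP hy, fun z hz => ?_⟩
  rw [RI_const hx l (fun z hz => hxQ.2 z (hFP hz)) y hy]
  exact hxQ.2 z hz

lemma RI_dich {n : ℕ} {F P : Set (Euc n)} {x : Euc n} (hP : Convex ℝ P) (hFP : F ⊆ P)
    (hx : x ∈ F) (hxP : x ∈ RI P) : RI F ⊆ RI P := by
  intro y hy
  by_contra hyP
  obtain ⟨l, h1, z, hz, h2⟩ := support hP (hFP hy.1) hyP
  have h3 := RI_const hy l (fun z hz => h1 z (hFP hz)) x hx
  have h4 := RI_const hxP l (fun z hz => h3 ▸ h1 z hz) z hz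
  linarith

lemma poly_convex {n : ℕ} {F : Set (Euc n)} (h : IsPolytope F) : Convex ℝ F := by
  obtain ⟨V, rfl⟩ := h
  exact convex_convexHull _ _

lemma poly_compact {n : ℕ} {F : Set (Euc n)} (h : IsPolytope F) : IsCompact F := by
  obtain ⟨V, rfl⟩ := h
  exact V.finite_toSet.isCompact_convexHull (𝕜 := ℝ)

namespace Subdivision

variable {n : ℕ} {P : Set (Euc n)} (S : Subdivision P)

lemma cell_sub {F : Set (Euc n)} (hF : F ∈ S.cells) : F ⊆ P := by
  intro x hx
  rw [← S.cover]
  exact Set.mem_biUnion (x := F) hF hx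

lemma exists_cell {x : Euc n} (hx : x ∈ P) : ∃ F ∈ S.cells, x ∈ RI F := by
  have hne : (S.cells.filter fun F => x ∈ F).Nonempty := by
    rw [← S.cover] at hx
    simp only [Set.mem_iUnion] at hx
    obtain ⟨F, hF, hxF⟩ := hx
    exact ⟨F, Finset.mem_filter.2 ⟨hF, hxF⟩⟩
  obtain ⟨F, hF⟩ := Finset.exists_minimal hne
  have hF1 := Finset.mem_filter.1 hF.1
  refine ⟨F, hF1.1, ?_⟩
  by_contra hxR
  obtain ⟨l, h1, z, hz, h2⟩ := support (poly_convex (S.poly F hF1.1)) hF1.2 hxR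
  set G := {y ∈ F | ∀ w ∈ F, l w ≤ l y} with hG
  have hxG : x ∈ G := ⟨hF1.2, h1⟩
  have hGc : G ∈ S.cells := S.face_mem F hF1.1 G (fun _ => ⟨l, rfl⟩) ⟨x, hxG⟩
  have h3 : F ≤ G := hF.2 (Finset.mem_filter.2 ⟨hGc, hxG⟩) (fun y hy => hy.1)
  have h4 := (h3 hz).2 x hF1.2
  linarith

lemma sub_of_mem {F G : Set (Euc n)} (hF : F ∈ S.cells) (hG : G ∈ S.cells) {x : Euc n}
    (hx : x ∈ RI F) (hxG : x ∈ G) : F ⊆ G := fun _ hy =>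
  (face_full (S.inter_face F hF G hG).1 hx ⟨hx.1, hxG⟩ hy).2

lemma uniq {F G : Set (Euc n)} (hF : F ∈ S.cells) (hG : G ∈ S.cells) {x : Euc n}
    (hx : x ∈ RI F) (hxG : x ∈ RI G) : F = G :=
  Set.Subset.antisymm (S.sub_of_mem hF hG hx hxG.1) (S.sub_of_mem hG hF hxG hx.1)

lemma cell_ro {F : Set (Euc n)} (hF : F ∈ S.cells) : RO (RI F) ∧ pdim (RI F) = pdim F :=
  RI_ro (poly_convex (S.poly F hF)) (S.nonempty_cells F hF) (poly_compact (S.poly F hF)).isBounded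

lemma sum_closed {K : Set (Euc n)} (hK : Convex ℝ K) (hKc : IsCompact K) (hne : K.Nonempty)
    (hKP : K ⊆ P) (h : ∀ G ∈ S.cells, ∀ x ∈ RI G, x ∈ K → G ⊆ K) :
    ∑ G ∈ S.cells.filter (fun G => G ⊆ K), (-1 : ℤ) ^ pdim G = 1 := by
  refine Eq.trans ?_ (key2 (S.cells.filter (fun G => G ⊆ K)) RI K 1 (Good.cpt hK hKc hne) ?_ ?_ ?_ ?_)
  · apply Finset.sum_congr rfl
    intro G hG
    rw [(S.cell_ro (Finset.mem_filter.1 hG).1).2]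
  · intro G hG
    exact (S.cell_ro (Finset.mem_filter.1 hG).1).1
  · intro G hG x hx
    exact (Finset.mem_filter.1 hG).2 hx.1
  · intro x hx
    obtain ⟨G, hG, hxG⟩ := S.exists_cell (hKP hx)
    exact ⟨G, Finset.mem_filter.2 ⟨hG, h G hG x hxG hx⟩, hxG⟩
  · intro F hF G hG x hx hx'
    exact S.uniq (Finset.mem_filter.1 hF).1 (Finset.mem_filter.1 hG).1 hx hx'

lemma sum_open (hP : IsPolytope P) {B : Set (Euc n)} (hB : IsOpen B) (hBc : Convex ℝ B)
    (hne : (P ∩ B).Nonempty) :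
    ∑ F ∈ S.cells.filter (fun F => RI F ⊆ RI P ∧ (F ∩ B).Nonempty), (-1 : ℤ) ^ pdim F
      = (-1) ^ pdim P := by
  have hPc := poly_convex hP
  obtain ⟨hP1, hP2⟩ := RI_ro hPc (hne.mono Set.inter_subset_left) (poly_compact hP).isBounded
  obtain ⟨hP3, hP4⟩ := ro_inter hP1 hB hBc (RI_dense hPc hB hne)
  have hcell : ∀ F ∈ S.cells.filter (fun F => RI F ⊆ RI P ∧ (F ∩ B).Nonempty),
      RO (RI F ∩ B) ∧ pdim (RI F ∩ B) = pdim F := by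
    intro F hF
    obtain ⟨h1, h2, h3⟩ := Finset.mem_filter.1 hF
    obtain ⟨h4, h5⟩ := S.cell_ro h1
    rw [← h5]
    exact ro_inter h4 hB hBc (RI_dense (poly_convex (S.poly F h1)) hB h3)
  rw [← hP2, ← hP4, ← key2 (S.cells.filter (fun F => RI F ⊆ RI P ∧ (F ∩ B).Nonempty))
    (fun F => RI F ∩ B) (RI P ∩ B) _ (Good.ro hP3)]
  · apply Finset.sum_congr rfl
    intro G hG
    rw [(hcell G hG).2]
  · intro G hG
    exact (hcell G hG).1
  · intro G hG
    exact Set.inter_subset_inter_left _ (Finset.mem_filter.1 hG).2.1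
  · rintro x ⟨hx, hxB⟩
    obtain ⟨G, hG, hxG⟩ := S.exists_cell hx.1
    exact ⟨G, Finset.mem_filter.2 ⟨hG, RI_dich hPc (S.cell_sub hG) hxG.1 hx, x, hxG.1, hxB⟩, hxG, hxB⟩
  · intro F hF G hG x hx hx'
    exact S.uniq (Finset.mem_filter.1 hF).1 (Finset.mem_filter.1 hG).1 hx.1 hx'.1

lemma sum_star (hP : IsPolytope P) {x : Euc n} (hx : x ∈ P) :
    ∑ F ∈ S.cells.filter (fun F => RI F ⊆ RI P ∧ x ∈ F), (-1 : ℤ) ^ pdim F = (-1) ^ pdim P := by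
  have hcl : IsClosed (⋃ F ∈ S.cells.filter (fun F => x ∉ F), F) := by
    apply Set.Finite.isClosed_biUnion (Finset.finite_toSet _)
    intro F hF
    exact (poly_compact (S.poly F (Finset.mem_filter.1 hF).1)).isClosed
  have hxc : x ∈ (⋃ F ∈ S.cells.filter (fun F => x ∉ F), F)ᶜ := by
    intro h
    simp only [Set.mem_iUnion] at h
    obtain ⟨F, hF, hxF⟩ := h
    exact (Finset.mem_filter.1 hF).2 hxF
  obtain ⟨ε, hε, hb⟩ := Metric.isOpen_iff.1 hcl.isOpen_compl x hxc
  rw [← S.sum_open hP (B := Metric.ball x ε) Metric.isOpen_ball (convex_ball x ε)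
    ⟨x, hx, Metric.mem_ball_self hε⟩]
  congr 1
  apply Finset.filter_congr
  intro F hF
  refine and_congr_right fun _ => ⟨fun h => ⟨x, h, Metric.mem_ball_self hε⟩, ?_⟩
  rintro ⟨y, hy, hyB⟩
  by_contra hxF
  apply hb hyB
  exact Set.mem_biUnion (x := F) (Finset.mem_filter.2 ⟨hF, hxF⟩) hy

end Subdivision

open Classical in
theorem statement0 {n : ℕ} (P : Set (Euc n)) (hP : IsPolytope P) (hdim : pdim P = n)
    (Q : Set (Euc n)) (hQface : IsExposed ℝ P Q) (hQproper : Q ≠ P)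
    (S : Subdivision P) :
    (∑ F ∈ S.cells,
        if F ∩ Q = ∅ ∧ intrinsicInterior ℝ F ⊆ intrinsicInterior ℝ P
        then (-1 : ℤ) ^ pdim F else 0)
      = if Q = ∅ then (-1 : ℤ) ^ n else 0 := by
  have hPc := poly_convex hP
  have hQP : Q ⊆ P := hQface.subset
  have hPne : P.Nonempty := by
    rw [Set.nonempty_iff_ne_empty]
    rintro rfl
    exact hQproper (Set.subset_empty_iff.1 hQP)
  have hspan : vectorSpan ℝ P = ⊤ := by
    apply Submodule.eq_top_of_finrank_eq
    rw [← pdim, hdim]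
    simp
  have hcond : ∀ F ∈ S.cells, (intrinsicInterior ℝ F ⊆ intrinsicInterior ℝ P ↔ RI F ⊆ RI P) := by
    intro F hF
    rw [RI_full hPc hPne hspan]
    constructor
    · intro h
      obtain ⟨x, hx⟩ := (S.nonempty_cells F hF).intrinsicInterior (poly_convex (S.poly F hF))
      exact RI_dich hPc (S.cell_sub hF) (intrinsicInterior_subset hx) (h hx)
    · exact fun h => intrinsic_subset_RI.trans h
  have hall : ∑ F ∈ S.cells.filter (fun F => RI F ⊆ RI P), (-1 : ℤ) ^ pdim F = (-1) ^ n := by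
    have := S.sum_open hP isOpen_univ convex_univ (by simpa using hPne)
    rw [hdim] at this
    rw [← this]
    congr 1
    apply Finset.filter_congr
    intro F hF
    simp [S.nonempty_cells F hF]
  have hinner : ∀ F ∈ S.cells, ∑ G ∈ S.cells.filter (fun G => G ⊆ F ∩ Q), (-1 : ℤ) ^ pdim G =
      if F ∩ Q = ∅ then 0 else 1 := by
    intro F hF
    split_ifs with h
    · apply Finset.sum_eq_zero
      intro G hG
      obtain ⟨h1, h2⟩ := Finset.mem_filter.1 hG
      rw [h, Set.subset_empty_iff] at h2
      exact absurd h2 (S.nonempty_cells G h1).ne_empty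
    · apply S.sum_closed
      · exact (poly_convex (S.poly F hF)).inter (hQface.convex hPc)
      · exact (poly_compact (S.poly F hF)).inter_right (hQface.isCompact (poly_compact hP)).isClosed
      · exact Set.nonempty_iff_ne_empty.2 h
      · exact Set.inter_subset_right.trans hQP
      · intro G hG x hx hxK
        exact Set.subset_inter (S.sub_of_mem hG hF hx hxK.1)
          (RI_face (S.cell_sub hG) hQface hx hxK.2)
  have hstar : ∀ G ∈ S.cells, ∑ F ∈ S.cells.filter (fun F => RI F ⊆ RI P ∧ G ⊆ F), (-1 : ℤ) ^ pdim F
      = (-1) ^ n := by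
    intro G hG
    obtain ⟨x, hx⟩ := RI_nonempty (poly_convex (S.poly G hG)) (S.nonempty_cells G hG)
    have := S.sum_star hP (S.cell_sub hG hx.1)
    rw [hdim] at this
    rw [← this]
    congr 1
    apply Finset.filter_congr
    intro F hF
    exact and_congr_right fun _ => ⟨fun h => h hx.1, fun h => S.sub_of_mem hG hF hx h⟩
  have hQsum : ∑ G ∈ S.cells.filter (fun G => G ⊆ Q), (-1 : ℤ) ^ pdim G = if Q = ∅ then 0 else 1 := by
    split_ifs with h
    · apply Finset.sum_eq_zero
      intro G hG
      obtain ⟨h1, h2⟩ := Finset.mem_filter.1 hG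
      rw [h, Set.subset_empty_iff] at h2
      exact absurd h2 (S.nonempty_cells G h1).ne_empty
    · apply S.sum_closed (hQface.convex hPc) (hQface.isCompact (poly_compact hP))
        (Set.nonempty_iff_ne_empty.2 h) hQP
      intro G hG x hx hxK
      exact RI_face (S.cell_sub hG) hQface hx hxK
  have hmeet : ∑ F ∈ S.cells.filter (fun F => RI F ⊆ RI P),
      (-1 : ℤ) ^ pdim F * (if F ∩ Q = ∅ then 0 else 1) = (-1) ^ n * if Q = ∅ then 0 else 1 := by
    calc _ = ∑ F ∈ S.cells.filter (fun F => RI F ⊆ RI P),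
          ∑ G ∈ S.cells.filter (fun G => G ⊆ F ∩ Q), (-1 : ℤ) ^ pdim F * (-1 : ℤ) ^ pdim G := by
          apply Finset.sum_congr rfl
          intro F hF
          rw [← Finset.mul_sum, hinner F (Finset.mem_filter.1 hF).1]
      _ = ∑ G ∈ S.cells.filter (fun G => G ⊆ Q),
          ∑ F ∈ S.cells.filter (fun F => RI F ⊆ RI P ∧ G ⊆ F), (-1 : ℤ) ^ pdim F * (-1 : ℤ) ^ pdim G := by
          apply Finset.sum_comm'
          intro F G
          simp only [Finset.mem_filter, Set.subset_inter_iff]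
          tauto
      _ = ∑ G ∈ S.cells.filter (fun G => G ⊆ Q), (-1) ^ n * (-1 : ℤ) ^ pdim G := by
          apply Finset.sum_congr rfl
          intro G hG
          rw [← Finset.sum_mul, hstar G (Finset.mem_filter.1 hG).1]
      _ = _ := by rw [← Finset.mul_sum, hQsum]
  have hfin : (∑ F ∈ S.cells,
        if F ∩ Q = ∅ ∧ intrinsicInterior ℝ F ⊆ intrinsicInterior ℝ P
        then (-1 : ℤ) ^ pdim F else 0) = (-1) ^ n - (-1) ^ n * if Q = ∅ then 0 else 1 := by
    rw [← hmeet, ← hall, ← Finset.sum_sub_distrib, Finset.sum_filter]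
    apply Finset.sum_congr rfl
    intro F hF
    rw [hcond F hF]
    by_cases h1 : F ∩ Q = ∅ <;> by_cases h2 : RI F ⊆ RI P <;> simp [h1, h2]
  rw [hfin]
  split_ifs <;> simp
end
end

section
/- For every lattice polytope P in a lattice M of rank n, the counting function f_P(m) = #(mP ∩ M) for positive integers m agrees with a polynomial in m of degree dim P (Ehrhart's theorem). -/
/- Statement 2 (Ehrhart's theorem): for every nonempty lattice polytope P in a lattice of
rank n, the counting function f_P(m) = #(mP ∩ M) for positive integers m agrees with a
polynomial in m of degree dim P. -/

open Classical Polynomial Pointwise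
noncomputable section

def intPt {n : ℕ} (v : Fin n → ℤ) : Euc n := fun i => (v i : ℝ)

def latticePts {n : ℕ} (P : Set (Euc n)) : Set (Fin n → ℤ) := {v | intPt v ∈ P}

namespace Ehr

/-- Lexicographic nonnegativity of a vector with respect to a list of coordinates. -/
def lexNN {ι : Type*} : List ι → (ι → ℝ) → Prop
  | [], _ => True
  | i :: l, μ => 0 < μ i ∨ (μ i = 0 ∧ lexNN l μ)

lemma lexNN_of_smul {ι : Type*} (l : List ι) (c : ℝ) (hc : 0 < c) (μ : ι → ℝ) :
    lexNN l (c • μ) → lexNN l μ := by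
  induction l with
  | nil => simp [lexNN]
  | cons i l ih =>
    simp only [lexNN, Pi.smul_apply, smul_eq_mul]
    rintro (h | ⟨h1, h2⟩)
    · exact Or.inl ((mul_pos_iff_of_pos_left hc).1 h)
    · exact Or.inr ⟨by simpa [hc.ne'] using h1, ih h2⟩

lemma lexNN_antisymm {ι : Type*} (l : List ι) (μ : ι → ℝ)
    (h1 : lexNN l μ) (h2 : lexNN l (-μ)) : ∀ i ∈ l, μ i = 0 := by
  induction l with
  | nil => simp
  | cons i l ih =>
    simp only [lexNN, Pi.neg_apply] at h1 h2
    have h0 : μ i = 0 := by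
      rcases h1 with h1 | h1
      · rcases h2 with h2 | h2 <;> linarith
      · exact h1.1
    have h1' : lexNN l μ := by
      rcases h1 with h1 | h1
      · exact absurd h0 h1.ne'
      · exact h1.2
    have h2' : lexNN l (-μ) := by
      rcases h2 with h2 | h2
      · linarith
      · exact h2.2
    intro j hj
    rcases List.mem_cons.1 hj with rfl | hj
    · exact h0
    · exact ih h1' h2' j hj

lemma exists_lexmin {ι : Type*} (l : List ι) : ∀ K : Set (ι → ℝ), IsCompact K → K.Nonempty →
    ∃ x ∈ K, ∀ y ∈ K, lexNN l (y - x) := by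
  induction l with
  | nil => rintro K - ⟨x, hx⟩; exact ⟨x, hx, fun _ _ => trivial⟩
  | cons i l ih =>
    intro K hK hne
    obtain ⟨z, hz, hmin⟩ := hK.exists_isMinOn hne (continuous_apply i).continuousOn
    have hcl : IsClosed {x : ι → ℝ | x i = z i} :=
      isClosed_eq (continuous_apply i) continuous_const
    obtain ⟨x, hx, hx'⟩ := ih (K ∩ {x | x i = z i}) (hK.inter_right hcl) ⟨z, hz, rfl⟩
    refine ⟨x, hx.1, fun y hy => ?_⟩
    have hxz : x i = z i := hx.2
    have hzy : z i ≤ y i := hmin hy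
    simp only [lexNN, Pi.sub_apply]
    rcases hzy.lt_or_eq with h | h
    · left; linarith
    · right; exact ⟨by linarith, hx' y ⟨hy, h.symm⟩⟩

variable {ι : Type} [Fintype ι] {n : ℕ}

/-- The homogenized linear combination map. -/
def LM (a : ι → Fin n → ℤ) : (ι → ℝ) →ₗ[ℝ] ℝ × Euc n :=
  Fintype.linearCombination ℝ (fun i => ((1 : ℝ), intPt (a i)))

lemma LM_apply (a : ι → Fin n → ℤ) (w : ι → ℝ) :
    LM a w = (∑ i, w i, ∑ i, w i • intPt (a i)) := by
  simp only [LM, Fintype.linearCombination_apply]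
  ext1 <;> simp [Prod.fst_sum, Prod.snd_sum]

def Good (a : ι → Fin n → ℤ) (S : Finset ι) : Prop :=
  ∀ μ : ι → ℝ, LM a μ = 0 → (∀ i, i ∉ S → 0 ≤ μ i) → lexNN (Finset.univ : Finset ι).toList μ

def Indep (a : ι → Fin n → ℤ) (S : Finset ι) : Prop :=
  ∀ μ : ι → ℝ, LM a μ = 0 → (∀ i, i ∉ S → μ i = 0) → μ = 0

def OpenPts (a : ι → Fin n → ℤ) (S : Finset ι) (m : ℕ) : Set (Fin n → ℤ) :=
  {x | ∃ w : ι → ℝ, (∀ i ∈ S, 0 < w i) ∧ (∀ i, i ∉ S → w i = 0) ∧ LM a w = ((m : ℝ), intPt x)}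

def Box (a : ι → Fin n → ℤ) (S : Finset ι) : Set (ℕ × (Fin n → ℤ)) :=
  {b | ∃ w : ι → ℝ, (∀ i ∈ S, 0 < w i ∧ w i ≤ 1) ∧ (∀ i, i ∉ S → w i = 0) ∧
    LM a w = ((b.1 : ℝ), intPt b.2)}

lemma Good.indep {a : ι → Fin n → ℤ} {S : Finset ι} (h : Good a S) : Indep a S := by
  intro μ h0 hS
  have h1 := h μ h0 (fun i hi => (hS i hi).ge)
  have h2 := h (-μ) (by simp [h0]) (fun i hi => by simp [hS i hi])
  ext i
  exact lexNN_antisymm _ _ h1 h2 i (by simp)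

lemma exists_good (a : ι → Fin n → ℤ) (y : ℝ × Euc n) (w₀ : ι → ℝ) (hw₀ : ∀ i, 0 ≤ w₀ i)
    (hy : LM a w₀ = y) :
    ∃ S : Finset ι, Good a S ∧ ∃ w : ι → ℝ, (∀ i ∈ S, 0 < w i) ∧ (∀ i, i ∉ S → w i = 0) ∧
      LM a w = y := by
  let K : Set (ι → ℝ) := {w | (∀ i, 0 ≤ w i) ∧ LM a w = y}
  have hKc : IsClosed K := by
    have h1 : IsClosed {w : ι → ℝ | ∀ i, 0 ≤ w i} := by
      simp only [Set.setOf_forall]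
      exact isClosed_iInter fun i => isClosed_le continuous_const (continuous_apply i)
    have h2 : IsClosed {w : ι → ℝ | LM a w = y} :=
      isClosed_eq (LinearMap.continuous_of_finiteDimensional _) continuous_const
    exact h1.inter h2
  have hK : IsCompact K := by
    refine IsCompact.of_isClosed_subset (isCompact_Icc (a := (0 : ι → ℝ)) (b := fun _ => y.1)) hKc ?_
    rintro w ⟨hw, hwy⟩
    refine ⟨hw, fun i => ?_⟩
    rw [LM_apply] at hwy
    rw [← hwy]
    exact Finset.single_le_sum (fun j _ => hw j) (Finset.mem_univ i)
  obtain ⟨w, ⟨hw, hwy⟩, hmin⟩ := exists_lexmin (Finset.univ : Finset ι).toList K hK ⟨w₀, hw₀, hy⟩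
  refine ⟨Finset.univ.filter (fun i => 0 < w i), ?_, w, by simp, ?_, hwy⟩
  · intro μ h0 hμ
    obtain ⟨c, hc, hc'⟩ : ∃ c : ℝ, 0 < c ∧ ∀ i, 0 ≤ w i + c * μ i := by
      have : ∀ i, ∀ᶠ c in nhdsWithin (0 : ℝ) (Set.Ioi 0), 0 ≤ w i + c * μ i := by
        intro i
        by_cases hi : 0 < w i
        · have ht : Filter.Tendsto (fun c : ℝ => w i + c * μ i) (nhds 0) (nhds (w i + 0 * μ i)) :=
            (by fun_prop : Continuous (fun c : ℝ => w i + c * μ i)).tendsto 0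
          have := ht.eventually (lt_mem_nhds (by simpa using hi : (0 : ℝ) < w i + 0 * μ i))
          exact (this.filter_mono nhdsWithin_le_nhds).mono fun c h => h.le
        · have := hμ i (by simpa using hi)
          filter_upwards [self_mem_nhdsWithin] with c hc
          exact add_nonneg (hw i) (mul_nonneg (le_of_lt hc) this)
      have := (Filter.eventually_all.2 this).and self_mem_nhdsWithin
      obtain ⟨c, h1, h2⟩ := this.exists
      exact ⟨c, h2, h1⟩
    have := hmin (w + c • μ) ⟨fun i => by simpa using hc' i, by simp [hwy, h0]⟩
    rw [add_sub_cancel_left] at this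
    exact lexNN_of_smul _ c hc _ this
  · intro i hi
    exact le_antisymm (by simpa using hi) (hw i)

lemma good_unique {a : ι → Fin n → ℤ} {S T : Finset ι} (hS : Good a S) (hT : Good a T)
    {m : ℕ} {x : Fin n → ℤ} (h1 : x ∈ OpenPts a S m) (h2 : x ∈ OpenPts a T m) : S = T := by
  obtain ⟨w, hw1, hw2, hw3⟩ := h1
  obtain ⟨v, hv1, hv2, hv3⟩ := h2
  have nn : ∀ i, 0 ≤ w i := fun i => by
    by_cases h : i ∈ S
    · exact (hw1 i h).le
    · exact (hw2 i h).ge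
  have nn' : ∀ i, 0 ≤ v i := fun i => by
    by_cases h : i ∈ T
    · exact (hv1 i h).le
    · exact (hv2 i h).ge
  have e1 := hS (v - w) (by simp [hw3, hv3]) (fun i hi => by simp [hw2 i hi, nn'])
  have e2 := hT (w - v) (by simp [hw3, hv3]) (fun i hi => by simp [hv2 i hi, nn])
  rw [← neg_sub] at e2
  have e : ∀ i, v i = w i := fun i => by
    have := lexNN_antisymm _ _ e1 e2 i (by simp)
    simp only [Pi.sub_apply] at this
    linarith
  ext i
  constructor
  · intro hi
    by_contra h
    have := hw1 i hi
    rw [← e, hv2 i h] at this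
    exact lt_irrefl _ this
  · intro hi
    by_contra h
    have := hv1 i hi
    rw [e, hw2 i h] at this
    exact lt_irrefl _ this

lemma box_finite (a : ι → Fin n → ℤ) (S : Finset ι) : (Box a S).Finite := by
  let M : Fin n → ℤ := fun j => ∑ i, |a i j|
  refine Set.Finite.subset (Finset.finite_toSet
    (Finset.range (Fintype.card ι + 1) ×ˢ Finset.Icc (-M) M)) ?_
  rintro ⟨h, x⟩ ⟨w, hw1, hw2, hw3⟩
  have hw : ∀ i, |w i| ≤ 1 := fun i => by
    by_cases hi : i ∈ S
    · rw [abs_of_pos (hw1 i hi).1]; exact (hw1 i hi).2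
    · simp [hw2 i hi]
  rw [LM_apply, Prod.mk.injEq] at hw3
  obtain ⟨e1, e2⟩ := hw3
  have hx : ∀ j, |x j| ≤ M j := by
    intro j
    have := congrFun e2 j
    simp only [Finset.sum_apply, Pi.smul_apply, intPt, smul_eq_mul] at this
    have h2 : |(x j : ℝ)| ≤ ((M j : ℤ) : ℝ) := by
      rw [← this]
      refine (Finset.abs_sum_le_sum_abs _ _).trans ?_
      simp only [M]
      push_cast
      refine Finset.sum_le_sum fun i _ => ?_
      rw [abs_mul]
      exact mul_le_of_le_one_left (abs_nonneg _) (hw i)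
    exact_mod_cast h2
  simp only [Finset.coe_product, Set.mem_prod, Finset.mem_coe, Finset.mem_range, Finset.mem_Icc]
  refine ⟨?_, fun j => (abs_le.1 (hx j)).1, fun j => (abs_le.1 (hx j)).2⟩
  have : (h : ℝ) ≤ Fintype.card ι := by
    have e1' : ∑ i, w i = (h : ℝ) := e1
    rw [← e1']
    refine (Finset.sum_le_card_nsmul _ _ 1 fun i _ => (le_abs_self _).trans (hw i)).trans ?_
    simp
  have : h ≤ Fintype.card ι := by exact_mod_cast this
  show h < _
  omega

lemma box_le {a : ι → Fin n → ℤ} {S : Finset ι} {b : ℕ × (Fin n → ℤ)} (hb : b ∈ Box a S) :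
    b.1 ≤ S.card := by
  obtain ⟨w, hw1, hw2, hw3⟩ := hb
  rw [LM_apply, Prod.mk.injEq] at hw3
  have e1 := hw3.1
  have : (b.1 : ℝ) ≤ S.card := by
    rw [← e1, ← Finset.sum_subset (Finset.subset_univ S) (fun i _ hi => hw2 i hi)]
    refine (Finset.sum_le_card_nsmul _ _ 1 fun i hi => (hw1 i hi).2).trans ?_
    simp
  exact_mod_cast this

lemma LM_nat (a : ι → Fin n → ℤ) (k : ι → ℕ) :
    LM a (fun i => (k i : ℝ)) = (((∑ i, k i : ℕ) : ℝ), intPt (∑ i, (k i : ℤ) • a i)) := by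
  rw [LM_apply]
  ext1
  · push_cast; rfl
  · ext j
    simp [intPt, Finset.sum_apply]

lemma intPt_add (x y : Fin n → ℤ) : intPt (x + y) = intPt x + intPt y := by
  ext j; simp [intPt]

lemma intPt_inj {x y : Fin n → ℤ} (h : intPt x = intPt y) : x = y := by
  ext j
  have := congrFun h j
  simpa [intPt] using this

def T (a : ι → Fin n → ℤ) (S : Finset ι) (m : ℕ) :
    Finset (Σ _ : ℕ × (Fin n → ℤ), ι → ℕ) :=
  ((box_finite a S).toFinset.filter (fun b => b.1 ≤ m)).sigma
    (fun b => Finset.piAntidiag S (m - b.1))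

def g (a : ι → Fin n → ℤ) (p : Σ _ : ℕ × (Fin n → ℤ), ι → ℕ) : Fin n → ℤ :=
  p.1.2 + ∑ i, (p.2 i : ℤ) • a i

lemma sum_univ_of_supp {S : Finset ι} {k : ι → ℕ} (hk : ∀ i, k i ≠ 0 → i ∈ S) :
    ∑ i, k i = S.sum k := by
  symm
  exact Finset.sum_subset (Finset.subset_univ S) (fun i _ hi => by
    by_contra h; exact hi (hk i h))

/-- Unpacking of membership in `T`. -/
lemma mem_T {a : ι → Fin n → ℤ} {S : Finset ι} {m : ℕ}
    {p : Σ _ : ℕ × (Fin n → ℤ), ι → ℕ} (hp : p ∈ T a S m) :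
    p.1.1 + ∑ i, p.2 i = m ∧ (∀ i, i ∉ S → p.2 i = 0) ∧
    ∃ w : ι → ℝ, (∀ i ∈ S, 0 < w i ∧ w i ≤ 1) ∧ (∀ i, i ∉ S → w i = 0) ∧
      LM a (w + fun i => (p.2 i : ℝ)) = ((m : ℝ), intPt (g a p)) := by
  obtain ⟨b, k⟩ := p
  simp only [T, Finset.mem_sigma, Finset.mem_filter, Set.Finite.mem_toFinset,
    Finset.mem_piAntidiag] at hp
  obtain ⟨⟨⟨w, hw1, hw2, hw3⟩, hbm⟩, hk1, hk2⟩ := hp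
  have hs : b.1 + ∑ i, k i = m := by rw [sum_univ_of_supp hk2, hk1]; omega
  refine ⟨hs, fun i hi => by_contra fun h => hi (hk2 i h), w, hw1, hw2, ?_⟩
  rw [map_add, hw3, LM_nat, g, intPt_add, Prod.mk_add_mk, ← hs]
  push_cast
  rfl

lemma openPts_eq (a : ι → Fin n → ℤ) (S : Finset ι) (m : ℕ) :
    OpenPts a S m = g a '' (T a S m : Set _) := by
  ext x
  constructor
  · rintro ⟨w, hw1, hw2, hw3⟩
    let k : ι → ℕ := fun i => ⌈w i⌉₊ - 1
    have hk0 : ∀ i, i ∉ S → k i = 0 := fun i hi => by simp [k, hw2 i hi]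
    have hk : ∀ i ∈ S, (k i : ℝ) < w i ∧ w i ≤ k i + 1 := by
      intro i hi
      have h1 : 0 < ⌈w i⌉₊ := Nat.ceil_pos.2 (hw1 i hi)
      have h2 : ((k i : ℕ) : ℝ) + 1 = ⌈w i⌉₊ := by
        simp only [k]
        rw [Nat.cast_sub h1]; simp
      have h3 := Nat.ceil_lt_add_one (hw1 i hi).le
      have h4 := Nat.le_ceil (w i)
      constructor <;> linarith
    have hle : ∑ i, k i ≤ m := by
      have e1 : ∑ i, w i = m := by
        rw [LM_apply, Prod.mk.injEq] at hw3; exact hw3.1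
      have : ((∑ i, k i : ℕ) : ℝ) ≤ m := by
        rw [← e1]; push_cast
        refine Finset.sum_le_sum fun i _ => ?_
        by_cases hi : i ∈ S
        · exact (hk i hi).1.le
        · simp [hk0 i hi, hw2 i hi]
      exact_mod_cast this
    let b : ℕ × (Fin n → ℤ) := (m - ∑ i, k i, x - ∑ i, (k i : ℤ) • a i)
    have hkS : ∀ i, k i ≠ 0 → i ∈ S := fun i h => by
      by_contra hi; exact h (hk0 i hi)
    refine ⟨⟨b, k⟩, ?_, ?_⟩
    · simp only [T, Finset.mem_coe, Finset.mem_sigma, Finset.mem_filter, Set.Finite.mem_toFinset,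
        Finset.mem_piAntidiag]
      refine ⟨⟨⟨w - fun i => (k i : ℝ), ?_, ?_, ?_⟩, ?_⟩, ?_, hkS⟩
      · intro i hi
        have := hk i hi
        simp only [Pi.sub_apply]
        constructor <;> linarith
      · intro i hi
        simp [hw2 i hi, hk0 i hi]
      · rw [map_sub, hw3, LM_nat, Prod.mk_sub_mk]
        simp only [b]
        rw [Nat.cast_sub hle]
        congr 1
        ext j; simp [intPt]
      · simp [b]
      · rw [← sum_univ_of_supp hkS]
        simp only [b]; omega
    · simp [g, b]
  · rintro ⟨p, hp, rfl⟩
    obtain ⟨-, hk, w, hw1, hw2, hw3⟩ := mem_T hp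
    refine ⟨_, ?_, ?_, hw3⟩
    · intro i hi
      have := (hw1 i hi).1
      simp only [Pi.add_apply]
      positivity
    · intro i hi
      simp [hw2 i hi, hk i hi]

lemma g_injOn {a : ι → Fin n → ℤ} {S : Finset ι} (hS : Indep a S) (m : ℕ) :
    Set.InjOn (g a) (T a S m : Set _) := by
  intro p hp q hq hpq
  obtain ⟨hs, hk, w, hw1, hw2, hw3⟩ := mem_T hp
  obtain ⟨hs', hk', w', hw1', hw2', hw3'⟩ := mem_T hq
  have h0 := hS ((w + fun i => (p.2 i : ℝ)) - (w' + fun i => (q.2 i : ℝ)))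
    (by rw [map_sub, hw3, hw3', hpq, sub_self])
    (fun i hi => by simp [hw2 i hi, hk i hi, hw2' i hi, hk' i hi])
  have e : p.2 = q.2 := by
    ext i
    by_cases hi : i ∈ S
    · have := congrFun h0 i
      simp only [Pi.sub_apply, Pi.add_apply, Pi.zero_apply] at this
      have h1 := hw1 i hi
      have h2 := hw1' i hi
      have l1 : (p.2 i : ℝ) < q.2 i + 1 := by linarith
      have l2 : (q.2 i : ℝ) < p.2 i + 1 := by linarith
      have l1' : p.2 i < q.2 i + 1 := by exact_mod_cast l1
      have l2' : q.2 i < p.2 i + 1 := by exact_mod_cast l2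
      omega
    · rw [hk i hi, hk' i hi]
  obtain ⟨⟨h, x⟩, k⟩ := p
  obtain ⟨⟨h', x'⟩, k'⟩ := q
  simp only at e hs hs'
  subst e
  simp only [g] at hpq
  have : x = x' := add_right_cancel hpq
  subst this
  have : h = h' := by omega
  subst this
  rfl

lemma card_piAntidiag' (S : Finset ι) (d r : ℕ) (hS : S.card = d + 1) :
    (Finset.piAntidiag S r).card = (r + d).choose d := by
  have : (Finset.piAntidiag S r).card = (S.finsuppAntidiag r).card := by
    symm
    refine Finset.card_bij (fun f _ => (f : ι → ℕ)) ?_ ?_ ?_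
    · intro f hf
      simp only [Finset.mem_finsuppAntidiag, Finset.mem_piAntidiag] at hf ⊢
      exact ⟨hf.1, fun i hi => hf.2 (by simpa using hi)⟩
    · intro f _ f' _ h
      exact DFunLike.coe_injective h
    · intro f hf
      simp only [Finset.mem_piAntidiag] at hf
      refine ⟨Finsupp.equivFunOnFinite.symm f, ?_, rfl⟩
      simp only [Finset.mem_finsuppAntidiag]
      refine ⟨hf.1, fun i hi => hf.2 i (by simpa using hi)⟩
  rw [this, Finset.card_finsuppAntidiag_nat_eq_choose, hS]
  rw [show d + 1 + r - 1 = r + d by omega, Nat.choose_symm_add]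

lemma pre_eval_zero (d h m : ℕ) (hm : m < h) (hd : h ≤ d + m) :
    (Polynomial.preHilbertPoly ℚ d h).eval (m : ℚ) = 0 := by
  have : (ascPochhammer ℚ d).eval (-((h - m - 1 : ℕ) : ℚ)) = 0 :=
    ascPochhammer_eval_neg_coe_nat_of_lt (by omega)
  have e : (-((h - m - 1 : ℕ) : ℚ)) = m - h + 1 := by
    rw [Nat.cast_sub (by omega), Nat.cast_sub (by omega)]; push_cast; ring
  rw [e] at this
  simp [Polynomial.preHilbertPoly, this]

/-- The Ehrhart polynomial of an open simplex. -/
def Q (a : ι → Fin n → ℤ) (S : Finset ι) : Polynomial ℚ :=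
  ∑ b ∈ (box_finite a S).toFinset, Polynomial.preHilbertPoly ℚ (S.card - 1) b.1

lemma openPts_finite (a : ι → Fin n → ℤ) (S : Finset ι) (m : ℕ) : (OpenPts a S m).Finite := by
  rw [openPts_eq]
  exact (Finset.finite_toSet _).image _

lemma ncard_openPts {a : ι → Fin n → ℤ} {S : Finset ι} (hS : Indep a S) (hne : S.Nonempty)
    {m : ℕ} (hm : 0 < m) : ((OpenPts a S m).ncard : ℚ) = (Q a S).eval (m : ℚ) := by
  rw [openPts_eq, Set.ncard_image_of_injOn (g_injOn hS m), Set.ncard_coe_finset, T,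
    Finset.card_sigma, Q, Polynomial.eval_finset_sum, Finset.sum_filter]
  push_cast
  refine Finset.sum_congr rfl fun b hb => ?_
  have hb' := box_le ((box_finite a S).mem_toFinset.1 hb)
  have hpos := hne.card_pos
  split_ifs with h
  · rw [Polynomial.preHilbertPoly_eq_choose_sub_add ℚ _ h, card_piAntidiag' S (S.card - 1) _ (by omega)]
  · rw [pre_eval_zero] <;> omega

lemma Q_natDegree_le (a : ι → Fin n → ℤ) (S : Finset ι) : (Q a S).natDegree ≤ S.card - 1 := by
  refine Polynomial.natDegree_sum_le_of_forall_le _ _ fun b _ => ?_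
  rw [Polynomial.natDegree_preHilbertPoly]

lemma Q_coeff_pos (a : ι → Fin n → ℤ) (S : Finset ι) : 0 < (Q a S).coeff (S.card - 1) := by
  rw [Q, Polynomial.finset_sum_coeff]
  simp only [Polynomial.coeff_preHilbertPoly_self]
  refine Finset.sum_pos (fun _ _ => by positivity) ?_
  rw [Set.Finite.toFinset_nonempty]
  let k : ι → ℕ := fun i => if i ∈ S then 1 else 0
  refine ⟨(∑ i, k i, ∑ i, (k i : ℤ) • a i), fun i => (k i : ℝ), ?_, ?_, LM_nat a k⟩
  · intro i hi; simp [k, hi]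
  · intro i hi; simp [k, hi]

/-- Comparison of degrees of polynomials on positive integers. -/
lemma coeff_compare {p q : Polynomial ℚ} {d : ℕ} (hq : q.natDegree ≤ d) (hqc : 0 < q.coeff d)
    (hp : p.natDegree ≤ d) (h : ∀ m : ℕ, 0 < m → q.eval (m : ℚ) ≤ p.eval (m : ℚ)) :
    p.degree = d := by
  refine (Polynomial.degree_le_of_natDegree_le hp).antisymm ?_
  by_contra hlt
  rw [not_le] at hlt
  have hp0 : p.coeff d = 0 := Polynomial.coeff_eq_zero_of_degree_lt hlt
  set r := q - p with hr
  have hrc : 0 < r.coeff d := by simp [hr, hp0, hqc]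
  have hrd : r.natDegree = d := by
    refine le_antisymm ((Polynomial.natDegree_sub_le _ _).trans (max_le hq hp)) ?_
    exact Polynomial.le_natDegree_of_ne_zero hrc.ne'
  have hr0 : ∀ m : ℕ, 0 < m → r.eval (m : ℚ) ≤ 0 := fun m hm => by
    have := h m hm
    simp only [hr, Polynomial.eval_sub]; linarith
  have hl : 0 < r.leadingCoeff := by rw [Polynomial.leadingCoeff, hrd]; exact hrc
  by_cases hd : 0 < r.degree
  · have ht := (r.tendsto_atTop_of_leadingCoeff_nonneg hd hl.le).comp
      (tendsto_natCast_atTop_atTop (R := ℚ))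
    obtain ⟨m, h1, h2⟩ := ((ht.eventually_gt_atTop 0).and (Filter.eventually_gt_atTop 0)).exists
    exact absurd (hr0 m h2) (not_le.2 h1)
  · rw [not_lt] at hd
    have := hr0 1 one_pos
    have hd0 := Polynomial.natDegree_eq_zero_iff_degree_le_zero.2 hd
    rw [Polynomial.eq_C_of_degree_le_zero hd, Polynomial.eval_C, ← hd0] at this
    exact absurd this (not_le.2 hl)

lemma mem_dilate (a : ι → Fin n → ℤ) {m : ℕ} (hm : 0 < m) (x : Fin n → ℤ) :
    x ∈ latticePts ((m : ℝ) • convexHull ℝ (Set.range fun i => intPt (a i))) ↔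
      ∃ w : ι → ℝ, (∀ i, 0 ≤ w i) ∧ LM a w = ((m : ℝ), intPt x) := by
  have hm' : (0 : ℝ) < m := by exact_mod_cast hm
  have key : ∀ y : Euc n, y ∈ convexHull ℝ (Set.range fun i => intPt (a i)) ↔
      ∃ w : ι → ℝ, (∀ i, 0 ≤ w i) ∧ LM a w = (1, y) := by
    intro y
    rw [convexHull_range_eq_exists_affineCombination]
    simp only [LM_apply, Prod.mk.injEq, Set.mem_setOf_eq]
    constructor
    · rintro ⟨s, w, h0, h1, rfl⟩
      refine ⟨fun i => if i ∈ s then w i else 0, fun i => ?_, ?_, ?_⟩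
      · dsimp only; split_ifs with h
        · exact h0 i h
        · exact le_rfl
      · simpa using h1
      · rw [Finset.affineCombination_eq_linear_combination _ _ _ h1]
        simp [ite_smul]
    · rintro ⟨w, h0, h1, h2⟩
      refine ⟨Finset.univ, w, fun i _ => h0 i, h1, ?_⟩
      rw [Finset.affineCombination_eq_linear_combination _ _ _ h1, h2]
  show intPt x ∈ (m : ℝ) • convexHull ℝ (Set.range fun i => intPt (a i)) ↔ _
  rw [Set.mem_smul_set_iff_inv_smul_mem₀ hm'.ne', key]
  constructor
  · rintro ⟨w, h0, h1⟩
    refine ⟨(m : ℝ) • w, fun i => mul_nonneg hm'.le (h0 i), ?_⟩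
    rw [map_smul, h1, Prod.smul_mk, smul_inv_smul₀ hm'.ne']; simp
  · rintro ⟨w, h0, h1⟩
    refine ⟨(m : ℝ)⁻¹ • w, fun i => mul_nonneg (inv_nonneg.2 hm'.le) (h0 i), ?_⟩
    rw [map_smul, h1, Prod.smul_mk]; simp [hm'.ne']

lemma openPts_empty (a : ι → Fin n → ℤ) {m : ℕ} (hm : 0 < m) : OpenPts a ∅ m = ∅ := by
  ext x
  simp only [Set.mem_empty_iff_false, iff_false]
  rintro ⟨w, -, h, h'⟩
  rw [LM_apply, Prod.mk.injEq] at h'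
  have := h'.1
  simp only [h _ (Finset.notMem_empty _), Finset.sum_const_zero] at this
  have : m = 0 := by exact_mod_cast this.symm
  omega

lemma indep_affine {a : ι → Fin n → ℤ} {S : Finset ι} (hS : Indep a S) :
    AffineIndependent ℝ (fun i : S => intPt (a i)) := by
  rw [affineIndependent_iff_of_fintype]
  intro w hw h i
  rw [Finset.weightedVSub_eq_linear_combination _ hw] at h
  have := hS (fun i => if hi : i ∈ S then w ⟨i, hi⟩ else 0) (by
    rw [LM_apply]
    have h1 : ∀ (E : Type) [AddCommMonoid E] (f : ι → E) , (∀ i, i ∉ S → f i = 0) →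
        ∑ i, f i = ∑ i : S, f i := fun E _ f hf => by
      rw [Finset.sum_coe_sort S f]
      exact (Finset.sum_subset (Finset.subset_univ S) (fun i _ hi => hf i hi)).symm
    rw [h1 _ _ (fun i hi => by simp [hi]), h1 _ _ (fun i hi => by simp [hi])]
    rw [Finset.univ_eq_attach] at hw h
    simp [hw, h]) (fun i hi => by simp [hi])
  simpa using congrFun this i

lemma affine_indep {a : ι → Fin n → ℤ} {S : Finset ι}
    (hS : AffineIndependent ℝ (fun i : S => intPt (a i))) : Indep a S := by
  rw [affineIndependent_iff] at hS
  intro μ h0 hμ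
  rw [LM_apply, Prod.mk_eq_zero] at h0
  have h1 : ∀ (E : Type) [AddCommMonoid E] (f : ι → E) , (∀ i, i ∉ S → f i = 0) →
      ∑ i : S, f i = ∑ i, f i := fun E _ f hf => by
    rw [Finset.sum_coe_sort S f]
    exact (Finset.sum_subset (Finset.subset_univ S) (fun i _ hi => hf i hi))
  have := hS Finset.univ (fun i => μ i) (by rw [h1 ℝ μ hμ, h0.1])
    (by rw [h1 _ (fun i => μ i • intPt (a i)) (fun i hi => by simp [hμ i hi]), h0.2])
  ext i
  by_cases hi : i ∈ S
  · exact this ⟨i, hi⟩ (Finset.mem_univ _)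
  · exact hμ i hi

lemma card_le {a : ι → Fin n → ℤ} {S : Finset ι} (hS : Indep a S) :
    S.card ≤ Module.finrank ℝ (vectorSpan ℝ (Set.range fun i => intPt (a i))) + 1 := by
  rcases S.eq_empty_or_nonempty with rfl | hne
  · simp
  haveI : Nonempty S := hne.to_subtype
  have h := (indep_affine hS).finrank_vectorSpan_add_one
  rw [Fintype.card_coe] at h
  rw [← h]
  gcongr
  apply Submodule.finrank_mono
  apply vectorSpan_mono
  rintro _ ⟨i, rfl⟩
  exact ⟨i, rfl⟩

lemma exists_basis [Nonempty ι] (a : ι → Fin n → ℤ) : ∃ S : Finset ι, Indep a S ∧ S.Nonempty ∧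
    S.card = Module.finrank ℝ (vectorSpan ℝ (Set.range fun i => intPt (a i))) + 1 := by
  obtain ⟨t, hts, hspan, hind⟩ := exists_affineIndependent ℝ (Euc n)
    (Set.range fun i => intPt (a i))
  choose f hf using fun x : t => hts x.2
  have hfinj : Function.Injective f := fun x y h => by
    apply Subtype.ext; rw [← hf x, ← hf y, h]
  haveI : Finite t := Finite.of_injective f hfinj
  haveI := Fintype.ofFinite t
  have htne : t.Nonempty := by
    rw [← affineSpan_nonempty ℝ, hspan, affineSpan_nonempty]
    exact Set.range_nonempty _
  haveI : Nonempty t := htne.to_subtype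
  let S : Finset ι := Finset.univ.image f
  have hcard : S.card = Fintype.card t := by
    rw [Finset.card_image_of_injective _ hfinj, Finset.card_univ]
  have hS : ∀ i : S, intPt (a i) ∈ t := by
    rintro ⟨i, hi⟩
    obtain ⟨x, -, rfl⟩ := Finset.mem_image.1 hi
    have := hf x
    simp only at this
    rw [this]; exact x.2
  refine ⟨S, affine_indep ?_, Finset.univ_nonempty.image f, ?_⟩
  · have := hind.comp_embedding (⟨fun i : S => (⟨intPt (a i), hS i⟩ : t), ?_⟩ : S ↪ t)
    · exact this
    · rintro ⟨i, hi⟩ ⟨j, hj⟩ h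
      obtain ⟨x, -, rfl⟩ := Finset.mem_image.1 hi
      obtain ⟨y, -, rfl⟩ := Finset.mem_image.1 hj
      have hx := hf x
      have hy := hf y
      simp only [Subtype.mk.injEq] at h hx hy
      rw [hx, hy] at h
      have := Subtype.ext h
      subst this
      rfl
  · rw [hcard, ← hind.finrank_vectorSpan_add_one, Subtype.range_coe, ← direction_affineSpan,
      ← direction_affineSpan, hspan]

theorem main [Nonempty ι] (a : ι → Fin n → ℤ) :
    ∃ p : Polynomial ℚ,
      p.degree = (pdim (convexHull ℝ (Set.range fun i => intPt (a i))) : ℕ) ∧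
      ∀ m : ℕ, 0 < m →
        ((latticePts ((m : ℝ) • convexHull ℝ (Set.range fun i => intPt (a i)))).ncard : ℚ)
          = p.eval (m : ℚ) := by
  have hdim : pdim (convexHull ℝ (Set.range fun i => intPt (a i))) =
      Module.finrank ℝ (vectorSpan ℝ (Set.range fun i => intPt (a i))) := by
    rw [pdim, ← direction_affineSpan, affineSpan_convexHull, direction_affineSpan]
  rw [hdim]
  set d := Module.finrank ℝ (vectorSpan ℝ (Set.range fun i => intPt (a i))) with hd
  let G : Finset (Finset ι) := Finset.univ.filter (fun S => Good a S ∧ S.Nonempty)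
  have hU : ∀ m : ℕ, 0 < m →
      latticePts ((m : ℝ) • convexHull ℝ (Set.range fun i => intPt (a i))) =
        (G.biUnion (fun S => (openPts_finite a S m).toFinset) : Finset _) := by
    intro m hm
    ext x
    rw [mem_dilate a hm]
    simp only [Finset.coe_biUnion, Set.Finite.coe_toFinset, Set.mem_iUnion, exists_prop,
      Finset.mem_coe, G, Finset.mem_filter, Finset.mem_univ, true_and]
    constructor
    · rintro ⟨w, h0, h1⟩
      obtain ⟨S, hS, w', hw'⟩ := exists_good a _ w h0 h1
      have hx : x ∈ OpenPts a S m := ⟨w', hw'⟩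
      refine ⟨S, ⟨hS, ?_⟩, hx⟩
      rw [Finset.nonempty_iff_ne_empty]
      rintro rfl
      rw [openPts_empty a hm] at hx
      exact hx
    · rintro ⟨S, -, w, h1, h2, h3⟩
      refine ⟨w, fun i => ?_, h3⟩
      by_cases h : i ∈ S
      · exact (h1 i h).le
      · exact (h2 i h).ge
  have hcount : ∀ m : ℕ, 0 < m →
      ((latticePts ((m : ℝ) • convexHull ℝ (Set.range fun i => intPt (a i)))).ncard : ℚ)
          = (∑ S ∈ G, Q a S).eval (m : ℚ) := by
    intro m hm
    rw [hU m hm, Set.ncard_coe_finset, Finset.card_biUnion, Polynomial.eval_finset_sum]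
    · push_cast
      refine Finset.sum_congr rfl fun S hS => ?_
      simp only [G, Finset.mem_filter, Finset.mem_univ, true_and] at hS
      rw [← ncard_openPts hS.1.indep hS.2 hm, Set.ncard_eq_toFinset_card _ (openPts_finite a S m)]
    · intro S hS S' hS' hne
      simp only [G, Finset.mem_filter, Finset.mem_univ, true_and, Finset.mem_coe] at hS hS'
      simp only [Function.onFun]
      rw [Finset.disjoint_left]
      intro x hx hx'
      rw [Set.Finite.mem_toFinset] at hx hx'
      exact hne (good_unique hS.1 hS'.1 hx hx')
  refine ⟨∑ S ∈ G, Q a S, ?_, hcount⟩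
  obtain ⟨B, hB, hBne, hBc⟩ := exists_basis a
  have hBd : B.card - 1 = d := by omega
  refine coeff_compare (q := Q a B) ?_ ?_ ?_ ?_
  · rw [← hBd]; exact Q_natDegree_le a B
  · rw [← hBd]; exact Q_coeff_pos a B
  · refine Polynomial.natDegree_sum_le_of_forall_le _ _ fun S hS => ?_
    simp only [G, Finset.mem_filter, Finset.mem_univ, true_and] at hS
    have := card_le hS.1.indep
    have := Q_natDegree_le a S
    omega
  · intro m hm
    rw [← ncard_openPts hB hBne hm, ← hcount m hm]
    norm_cast
    refine Set.ncard_le_ncard ?_ ?_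
    · rintro x ⟨w, h1, h2, h3⟩
      rw [mem_dilate a hm]
      refine ⟨w, fun i => ?_, h3⟩
      by_cases h : i ∈ B
      · exact (h1 i h).le
      · exact (h2 i h).ge
    · rw [hU m hm]; exact Finset.finite_toSet _

end Ehr

theorem statement2 {n : ℕ} (V : Finset (Fin n → ℤ)) (hV : V.Nonempty)
    (P : Set (Euc n)) (hP : P = convexHull ℝ (intPt '' (V : Set (Fin n → ℤ)))) :
    ∃ p : Polynomial ℚ, p.degree = (pdim P : ℕ) ∧
      ∀ m : ℕ, 0 < m →
        ((latticePts ((m : ℝ) • P)).ncard : ℚ) = p.eval (m : ℚ) := by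
  subst hP
  haveI : Nonempty V := hV.to_subtype
  have h := Ehr.main (fun v : V => (v : Fin n → ℤ))
  have e : (Set.range fun v : V => intPt (v : Fin n → ℤ)) =
      intPt '' (V : Set (Fin n → ℤ)) := by
    ext x; simp
  rw [e] at h
  exact h
end
end

section
/- Any two valuations on the set of lattice polytopes in a fixed lattice M that agree on all unimodular simplices are equal. -/
/- Statement 4: any two valuations on the set of lattice polytopes in a fixed lattice
that agree on all unimodular simplices are equal. -/

open Classical Polynomial Pointwise
noncomputable section

def IsLatticePolytope {n : ℕ} (P : Set (Euc n)) : Prop :=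
  ∃ V : Finset (Fin n → ℤ), P = convexHull ℝ (intPt '' (V : Set (Fin n → ℤ)))

def relBoundary {n : ℕ} (P : Set (Euc n)) : Set (Euc n) := P \ intrinsicInterior ℝ P

/-- The points (v, ω v) for v a lattice point of P, lifted by a height function ω. -/
def liftedPts {n : ℕ} (P : Set (Euc n)) (ω : (Fin n → ℤ) → ℝ) : Set (Euc n × ℝ) :=
  {p | ∃ v ∈ latticePts P, p = (intPt v, ω v)}

/-- The lower convex envelope of the height function ω over P. -/
def lowerEnv {n : ℕ} (P : Set (Euc n)) (ω : (Fin n → ℤ) → ℝ) (x : Euc n) : ℝ :=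
  sInf {t | (x, t) ∈ convexHull ℝ (liftedPts P ω)}

/-- A cell of the regular subdivision induced by the height function ω: the locus in P
where some affine function lying below the lower envelope is attained. -/
def IsRegularCell {n : ℕ} (P : Set (Euc n)) (ω : (Fin n → ℤ) → ℝ) (F : Set (Euc n)) :
    Prop :=
  F.Nonempty ∧ ∃ a : Euc n →ᵃ[ℝ] ℝ, (∀ x ∈ P, a x ≤ lowerEnv P ω x) ∧
    F = {x ∈ P | a x = lowerEnv P ω x}

def IsRegularSubdivision {n : ℕ} (P : Set (Euc n)) (S : Subdivision P) : Prop :=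
  ∃ ω : (Fin n → ℤ) → ℝ, (↑S.cells : Set (Set (Euc n))) = {F | IsRegularCell P ω F}

/-- The affine map x ↦ A x + u given by an integer matrix A and an integer vector u. -/
def unimodMap {n : ℕ} (A : Matrix (Fin n) (Fin n) ℤ) (u : Fin n → ℤ) (x : Euc n) :
    Euc n :=
  (A.map (Int.cast : ℤ → ℝ)).mulVec x + intPt u

/-- A G-valued valuation on lattice polytopes in ℤⁿ. -/
structure IsValuation {n : ℕ} {G : Type*} [AddCommGroup G] (φ : Set (Euc n) → G) :
    Prop where
  subdiv : ∀ P : Set (Euc n), IsLatticePolytope P → ∀ S : Subdivision P,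
    (∀ F ∈ S.cells, IsLatticePolytope F) → IsRegularSubdivision P S →
    φ P = ∑ F ∈ S.cells,
      (if F ⊆ relBoundary P then 0 else ((-1 : ℤ) ^ (pdim P - pdim F)) • φ F)
  empty : φ ∅ = 0
  unimod_invariant : ∀ P : Set (Euc n), IsLatticePolytope P →
    ∀ A : Matrix (Fin n) (Fin n) ℤ, IsUnit A.det → ∀ u : Fin n → ℤ,
      φ (unimodMap A u '' P) = φ P

/-- The standard k-dimensional simplex Conv{0, e₁, …, e_k} in ℝⁿ. -/
def stdSimplexSet (n k : ℕ) : Set (Euc n) :=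
  convexHull ℝ (insert 0
    (Set.range fun j : Fin k => fun i : Fin n => if (i : ℕ) = (j : ℕ) then (1 : ℝ) else 0))

/-- A unimodular simplex: the image of a standard simplex under a unimodular affine map. -/
def IsUnimodularSimplex {n : ℕ} (P : Set (Euc n)) : Prop :=
  ∃ k : ℕ, k ≤ n ∧ ∃ A : Matrix (Fin n) (Fin n) ℤ, IsUnit A.det ∧ ∃ u : Fin n → ℤ,
    P = unimodMap A u '' stdSimplexSet n k


lemma farkas {V ι : Type*} [AddCommGroup V] [Module ℝ V] (s : Finset ι) :
    ∀ (g : ι → V) (b : V), (∃ c : ι → ℝ, (∀ i ∈ s, 0 ≤ c i) ∧ b = ∑ i ∈ s, c i • g i) ∨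
      ∃ l : V →ₗ[ℝ] ℝ, (∀ i ∈ s, 0 ≤ l (g i)) ∧ l b < 0 := by
  induction s using Finset.induction_on with
  | empty =>
    intro g b
    by_cases hb : b = 0
    · left; exact ⟨0, by simp, by simp [hb]⟩
    · right
      obtain ⟨f, hf⟩ : ∃ f : Module.Dual ℝ V, f b ≠ 0 := by
        by_contra! h
        exact hb ((Module.forall_dual_apply_eq_zero_iff ℝ b).1 h)
      rcases lt_or_gt_of_ne hf with h | h
      · exact ⟨f, by simp, h⟩
      · exact ⟨-f, by simp, by simpa using h⟩
  | insert j s hj ih =>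
    intro g b
    rcases ih g b with ⟨c, hc, hb⟩ | ⟨l, hl, hlb⟩
    · left
      refine ⟨Function.update c j 0, ?_, ?_⟩
      · intro i hi
        by_cases h : i = j
        · simp [h]
        · simpa [h] using hc i (by simpa [h] using hi)
      · rw [Finset.sum_insert hj, hb]
        simp only [Function.update_self, zero_smul, zero_add]
        apply Finset.sum_congr rfl
        intro i hi
        rw [Function.update_of_ne (by rintro rfl; exact hj hi)]
    · by_cases hg : 0 ≤ l (g j)
      · right
        refine ⟨l, ?_, hlb⟩
        intro i hi
        rcases Finset.mem_insert.1 hi with rfl | h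
        · exact hg
        · exact hl i h
      · push Not at hg
        rcases ih (fun i => g i - (l (g i) / l (g j)) • g j) (b - (l b / l (g j)) • g j) with
          ⟨c, hc, hb⟩ | ⟨m, hm, hmb⟩
        · left
          refine ⟨Function.update c j (l b / l (g j) + ∑ i ∈ s, c i * (-(l (g i) / l (g j)))), ?_, ?_⟩
          · intro i hi
            by_cases h : i = j
            · subst h
              simp only [Function.update_self]
              apply add_nonneg (div_nonneg_of_nonpos hlb.le hg.le)
              apply Finset.sum_nonneg
              intro k hk
              apply mul_nonneg (hc k hk)
              rw [neg_nonneg]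
              exact div_nonpos_of_nonneg_of_nonpos (hl k hk) hg.le
            · simpa [h] using hc i (by simpa [h] using hi)
          · rw [Finset.sum_insert hj]
            simp only [Function.update_self]
            have : ∑ i ∈ s, Function.update c j (l b / l (g j) + ∑ i ∈ s, c i * (-(l (g i) / l (g j)))) i • g i
                = ∑ i ∈ s, c i • g i := by
              apply Finset.sum_congr rfl
              intro i hi
              rw [Function.update_of_ne (by rintro rfl; exact hj hi)]
            rw [this, add_smul, Finset.sum_smul]
            rw [sub_eq_iff_eq_add] at hb
            generalize l b / l (g j) = r at hb ⊢
            rw [hb, add_comm _ (r • g j), add_assoc, ← Finset.sum_add_distrib]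
            congr 1
            apply Finset.sum_congr rfl
            intro i hi
            module
        · right
          refine ⟨m ∘ₗ (LinearMap.id - (LinearMap.toSpanSingleton ℝ V (g j)) ∘ₗ ((l (g j))⁻¹ • l)), ?_, ?_⟩
          · intro i hi
            rcases Finset.mem_insert.1 hi with rfl | h
            · simp [hg.ne]
            · have := hm i h
              simpa [div_eq_inv_mul] using this
          · simpa [div_eq_inv_mul] using hmb

lemma mem_hull_image {E ι : Type*} [AddCommGroup E] [Module ℝ E] (T : Finset ι) (f : ι → E) (x : E) :
    x ∈ convexHull ℝ (f '' (T : Set ι)) ↔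
      ∃ w : ι → ℝ, (∀ i ∈ T, 0 ≤ w i) ∧ ∑ i ∈ T, w i = 1 ∧ ∑ i ∈ T, w i • f i = x := by
  constructor
  · intro hx
    have hc : Convex ℝ {x : E | ∃ w : ι → ℝ, (∀ i ∈ T, 0 ≤ w i) ∧ ∑ i ∈ T, w i = 1 ∧
        ∑ i ∈ T, w i • f i = x} := by
      rintro x ⟨w, h1, h2, h3⟩ y ⟨w', h1', h2', h3'⟩ a b ha hb hab
      refine ⟨fun i => a * w i + b * w' i, ?_, ?_, ?_⟩
      · intro i hi
        have := h1 i hi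
        have := h1' i hi
        positivity
      · rw [Finset.sum_add_distrib, ← Finset.mul_sum, ← Finset.mul_sum, h2, h2']; simpa using hab
      · rw [← h3, ← h3', Finset.smul_sum, Finset.smul_sum, ← Finset.sum_add_distrib]
        apply Finset.sum_congr rfl
        intro i _
        module
    refine convexHull_min ?_ hc hx
    rintro _ ⟨i, hi, rfl⟩
    refine ⟨Pi.single i 1, ?_, ?_, ?_⟩
    · intro k _
      by_cases h : k = i
      · subst h; simp
      · simp [h]
    · rw [Finset.sum_pi_single']; simpa using hi
    · rw [Finset.sum_eq_single_of_mem i hi]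
      · simp
      · intro k _ h; simp [h]
  · rintro ⟨w, h1, h2, rfl⟩
    exact (convex_convexHull ℝ _).sum_mem h1 h2
      (fun i hi => subset_convexHull ℝ _ ⟨i, hi, rfl⟩)

lemma aff_sum {E ι : Type*} [AddCommGroup E] [Module ℝ E] (a : E →ᵃ[ℝ] ℝ) (T : Finset ι)
    (w : ι → ℝ) (f : ι → E) (hw : ∑ i ∈ T, w i = 1) :
    a (∑ i ∈ T, w i • f i) = ∑ i ∈ T, w i * a (f i) := by
  have h : ∀ x, a x = a.linear x + a 0 := fun x => by
    have := congrFun a.decomp x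
    simpa using this
  rw [h, map_sum]
  simp_rw [h (f _), mul_add, Finset.sum_add_distrib, ← Finset.sum_mul, hw]
  simp

lemma lattice_fin {n : ℕ} {P : Set (Euc n)} (hP : IsLatticePolytope P) :
    (latticePts P).Finite ∧ P = convexHull ℝ (intPt '' latticePts P) := by
  obtain ⟨V, hV⟩ := hP
  have hcomp : IsCompact P := by
    rw [hV]; exact (V.finite_toSet.image _).isCompact_convexHull ℝ
  constructor
  · obtain ⟨R, hR⟩ := hcomp.isBounded.exists_norm_le
    apply (Set.finite_Icc (fun _ : Fin n => -⌈R⌉) (fun _ : Fin n => ⌈R⌉)).subset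
    intro v hv
    have h1 := hR _ hv
    have h2 : ∀ i, |(v i : ℝ)| ≤ R := fun i => (norm_le_pi_norm (intPt v) i).trans h1
    constructor
    · intro i
      have h3 := (abs_le.1 (h2 i)).1
      have : (-⌈R⌉ : ℝ) ≤ v i := by linarith [Int.le_ceil R]
      exact_mod_cast this
    · intro i
      have h3 := (abs_le.1 (h2 i)).2
      have : (v i : ℝ) ≤ ⌈R⌉ := by linarith [Int.le_ceil R]
      exact_mod_cast this
  · apply Set.Subset.antisymm
    · conv_lhs => rw [hV]
      apply convexHull_mono
      apply Set.image_mono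
      intro v hv
      change intPt v ∈ P
      rw [hV]
      exact subset_convexHull ℝ _ ⟨v, hv, rfl⟩
    · apply convexHull_min
      · rintro _ ⟨v, hv, rfl⟩; exact hv
      · rw [hV]; exact convex_convexHull ℝ _

lemma lifted_eq {n : ℕ} (P : Set (Euc n)) (ω : (Fin n → ℤ) → ℝ) :
    liftedPts P ω = (fun v => (intPt v, ω v)) '' latticePts P := by
  ext p; constructor
  · rintro ⟨v, hv, rfl⟩; exact ⟨v, hv, rfl⟩
  · rintro ⟨v, hv, rfl⟩; exact ⟨v, hv, rfl⟩

lemma mem_P_iff {n : ℕ} {P : Set (Euc n)} (hP : IsLatticePolytope P) (x : Euc n) :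
    x ∈ P ↔ ∃ w : (Fin n → ℤ) → ℝ, (∀ i ∈ (lattice_fin hP).1.toFinset, 0 ≤ w i) ∧
      ∑ i ∈ (lattice_fin hP).1.toFinset, w i = 1 ∧
      ∑ i ∈ (lattice_fin hP).1.toFinset, w i • intPt i = x := by
  rw [← mem_hull_image, Set.Finite.coe_toFinset, ← (lattice_fin hP).2]

lemma mem_lift_iff {n : ℕ} {P : Set (Euc n)} (hP : IsLatticePolytope P) (ω : (Fin n → ℤ) → ℝ)
    (x : Euc n) (t : ℝ) :
    (x, t) ∈ convexHull ℝ (liftedPts P ω) ↔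
    ∃ w : (Fin n → ℤ) → ℝ, (∀ i ∈ (lattice_fin hP).1.toFinset, 0 ≤ w i) ∧
      ∑ i ∈ (lattice_fin hP).1.toFinset, w i = 1 ∧
      ∑ i ∈ (lattice_fin hP).1.toFinset, w i • intPt i = x ∧
      ∑ i ∈ (lattice_fin hP).1.toFinset, w i * ω i = t := by
  have := mem_hull_image (lattice_fin hP).1.toFinset (fun v => (intPt v, ω v)) (x, t)
  rw [Set.Finite.coe_toFinset, ← lifted_eq] at this
  rw [this]
  simp [Prod.ext_iff, Prod.fst_sum, Prod.snd_sum]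

lemma env_set_compact {n : ℕ} {P : Set (Euc n)} (hP : IsLatticePolytope P)
    (ω : (Fin n → ℤ) → ℝ) (x : Euc n) :
    IsCompact {t | (x, t) ∈ convexHull ℝ (liftedPts P ω)} := by
  have hK : IsCompact (convexHull ℝ (liftedPts P ω)) := by
    rw [lifted_eq]; exact ((lattice_fin hP).1.image _).isCompact_convexHull ℝ
  have : {t | (x, t) ∈ convexHull ℝ (liftedPts P ω)} =
      Prod.snd '' (convexHull ℝ (liftedPts P ω) ∩ {p | p.1 = x}) := by
    ext t; constructor
    · intro h; exact ⟨(x, t), ⟨h, rfl⟩, rfl⟩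
    · rintro ⟨⟨y, s⟩, ⟨h, h'⟩, rfl⟩
      have h'' : y = x := h'
      subst h''; exact h
  rw [this]
  exact (hK.inter_right (isClosed_eq continuous_fst continuous_const)).image continuous_snd

lemma env_set_nonempty {n : ℕ} {P : Set (Euc n)} (hP : IsLatticePolytope P)
    (ω : (Fin n → ℤ) → ℝ) {x : Euc n} (hx : x ∈ P) :
    {t | (x, t) ∈ convexHull ℝ (liftedPts P ω)}.Nonempty := by
  obtain ⟨w, h1, h2, h3⟩ := (mem_P_iff hP x).1 hx
  exact ⟨_, (mem_lift_iff hP ω x _).2 ⟨w, h1, h2, h3, rfl⟩⟩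

lemma env_mem {n : ℕ} {P : Set (Euc n)} (hP : IsLatticePolytope P)
    (ω : (Fin n → ℤ) → ℝ) {x : Euc n} (hx : x ∈ P) :
    (x, lowerEnv P ω x) ∈ convexHull ℝ (liftedPts P ω) :=
  (env_set_compact hP ω x).sInf_mem (env_set_nonempty hP ω hx)

lemma env_le {n : ℕ} {P : Set (Euc n)} (hP : IsLatticePolytope P)
    (ω : (Fin n → ℤ) → ℝ) {x : Euc n} {t : ℝ} (hx : (x, t) ∈ convexHull ℝ (liftedPts P ω)) :
    lowerEnv P ω x ≤ t :=
  csInf_le (env_set_compact hP ω x).bddBelow hx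

lemma env_le_height {n : ℕ} {P : Set (Euc n)} (hP : IsLatticePolytope P)
    (ω : (Fin n → ℤ) → ℝ) {v : Fin n → ℤ} (hv : v ∈ latticePts P) :
    lowerEnv P ω (intPt v) ≤ ω v :=
  env_le hP ω (subset_convexHull ℝ _ ⟨v, hv, rfl⟩)

lemma le_env {n : ℕ} {P : Set (Euc n)} (hP : IsLatticePolytope P)
    (ω : (Fin n → ℤ) → ℝ) (a : Euc n →ᵃ[ℝ] ℝ) (ha : ∀ v ∈ latticePts P, a (intPt v) ≤ ω v)
    {x : Euc n} (hx : x ∈ P) : a x ≤ lowerEnv P ω x := by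
  obtain ⟨w, h1, h2, h3, h4⟩ := (mem_lift_iff hP ω x _).1 (env_mem hP ω hx)
  rw [← h4, ← h3, aff_sum a _ w _ h2]
  apply Finset.sum_le_sum
  intro i hi
  exact mul_le_mul_of_nonneg_left (ha i (by simpa using hi)) (h1 i hi)

lemma cell_eq {n : ℕ} {P : Set (Euc n)} (hP : IsLatticePolytope P)
    (ω : (Fin n → ℤ) → ℝ) (a : Euc n →ᵃ[ℝ] ℝ) (ha : ∀ v ∈ latticePts P, a (intPt v) ≤ ω v) :
    {x ∈ P | a x = lowerEnv P ω x} =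
      convexHull ℝ (intPt '' {v ∈ latticePts P | a (intPt v) = ω v}) := by
  apply Set.Subset.antisymm
  · rintro x ⟨hx, hax⟩
    obtain ⟨w, h1, h2, h3, h4⟩ := (mem_lift_iff hP ω x _).1 (env_mem hP ω hx)
    rw [← hax, ← h3, aff_sum a _ w _ h2] at h4
    have h5 : ∑ i ∈ (lattice_fin hP).1.toFinset, w i * (ω i - a (intPt i)) = 0 := by
      simp_rw [mul_sub, Finset.sum_sub_distrib]; linarith
    rw [Finset.sum_eq_zero_iff_of_nonneg] at h5
    · have h6 : ∀ i ∈ (lattice_fin hP).1.toFinset, w i ≠ 0 → a (intPt i) = ω i := by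
        intro i hi hw
        rcases mul_eq_zero.1 (h5 i hi) with h | h
        · exact absurd h hw
        · linarith
      have hT := mem_hull_image ((lattice_fin hP).1.toFinset.filter (fun v => a (intPt v) = ω v)) intPt x
      have hco : (((lattice_fin hP).1.toFinset.filter (fun v => a (intPt v) = ω v) : Finset _) : Set (Fin n → ℤ))
          = {v ∈ latticePts P | a (intPt v) = ω v} := by
        ext v; simp
      rw [hco] at hT
      rw [hT]
      refine ⟨w, ?_, ?_, ?_⟩
      · intro i hi; exact h1 i (Finset.mem_filter.1 hi).1
      · rw [Finset.sum_filter_of_ne, h2]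
        intro i hi hw; exact h6 i hi hw
      · rw [Finset.sum_filter_of_ne, h3]
        intro i hi hw
        apply h6 i hi
        rintro h; simp [h] at hw
    · intro i hi
      apply mul_nonneg (h1 i hi)
      have := ha i (by simpa using hi)
      linarith
  · intro x hx
    have hxP : x ∈ P := by
      rw [(lattice_fin hP).2]
      exact convexHull_mono (Set.image_mono (fun v hv => hv.1)) hx
    refine ⟨hxP, le_antisymm (le_env hP ω a ha hxP) ?_⟩
    apply env_le hP
    have h1 : ((AffineMap.id ℝ (Euc n)).prod a) x ∈
        ((AffineMap.id ℝ (Euc n)).prod a) '' convexHull ℝ (intPt '' {v ∈ latticePts P | a (intPt v) = ω v}) :=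
      ⟨x, hx, rfl⟩
    rw [AffineMap.image_convexHull] at h1
    refine convexHull_mono ?_ h1
    rintro _ ⟨_, ⟨v, ⟨hv, hv'⟩, rfl⟩, rfl⟩
    exact ⟨v, hv, by simp [hv']⟩

lemma subgrad {n : ℕ} {P : Set (Euc n)} (hP : IsLatticePolytope P)
    (ω : (Fin n → ℤ) → ℝ) {x : Euc n} (_hx : x ∈ P) :
    ∃ a : Euc n →ᵃ[ℝ] ℝ, (∀ v ∈ latticePts P, a (intPt v) ≤ ω v) ∧ a x = lowerEnv P ω x := by
  set e := lowerEnv P ω x with he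
  set L := (lattice_fin hP).1.toFinset with hL
  rcases farkas (insert none (L.image some))
    (fun o : Option (Fin n → ℤ) => match o with
      | none => ((0, 1) : Euc n × ℝ)
      | some v => (intPt v - x, ω v - e)) ((0, -1) : Euc n × ℝ) with ⟨c, hc, hb⟩ | ⟨l, hl, hlb⟩
  · exfalso
    rw [Finset.sum_insert (by simp), Finset.sum_image (by simp)] at hb
    have hb1 := congrArg Prod.fst hb
    have hb2 := congrArg Prod.snd hb
    simp only [Prod.fst_add, Prod.snd_add, Prod.fst_sum, Prod.snd_sum, Prod.smul_fst, Prod.smul_snd,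
      smul_zero, zero_add, smul_eq_mul, mul_one] at hb1 hb2
    have hc0 : 0 ≤ c none := hc _ (by simp)
    have hcL : ∀ v ∈ L, 0 ≤ c (some v) := fun v hv => hc _ (by simp [hv])
    set C := ∑ v ∈ L, c (some v) with hC
    have hCpos : 0 < C := by
      rcases (Finset.sum_nonneg hcL).lt_or_eq with h | h
      · exact h
      · exfalso
        have h0 := (Finset.sum_eq_zero_iff_of_nonneg hcL).1 h.symm
        have : ∑ v ∈ L, c (some v) * (ω v - e) = 0 :=
          Finset.sum_eq_zero (fun v hv => by rw [h0 v hv, zero_mul])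
        linarith
    have hkey : (x, ∑ v ∈ L, c (some v) / C * ω v) ∈ convexHull ℝ (liftedPts P ω) := by
      rw [mem_lift_iff hP]
      refine ⟨fun v => c (some v) / C, ?_, ?_, ?_, rfl⟩
      · intro v hv; exact div_nonneg (hcL v hv) hCpos.le
      · rw [← Finset.sum_div]; exact div_self hCpos.ne'
      · simp_rw [smul_sub, Finset.sum_sub_distrib, ← Finset.sum_smul] at hb1
        have h2 : ∑ v ∈ L, c (some v) • intPt v = C • x := by
          rw [eq_comm, sub_eq_zero] at hb1; exact hb1
        simp_rw [div_eq_inv_mul, mul_smul, ← Finset.smul_sum]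
        rw [← hL, h2, smul_smul, inv_mul_cancel₀ hCpos.ne', one_smul]
    have h3 := env_le hP ω hkey
    rw [← he] at h3
    simp_rw [mul_sub, Finset.sum_sub_distrib, ← Finset.sum_mul] at hb2
    have h4 : ∑ v ∈ L, c (some v) / C * ω v = (∑ v ∈ L, c (some v) * ω v) / C := by
      rw [Finset.sum_div]; apply Finset.sum_congr rfl; intro i _; ring
    rw [h4, le_div_iff₀ hCpos] at h3
    rw [← hC] at hb2
    linarith
  · have hs0 : 0 < l (0, 1) := by
      have : ((0, -1) : Euc n × ℝ) = -(0, 1) := by simp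
      rw [this, map_neg] at hlb; linarith
    set s := l (0, 1) with hs
    have hlin : ∀ (y : Euc n) (t : ℝ), l (y, t) = l (y, 0) + t * s := by
      intro y t
      have : ((y, t) : Euc n × ℝ) = (y, 0) + t • (0, 1) := by simp
      rw [this, map_add, map_smul, smul_eq_mul]
    let m : Euc n →ₗ[ℝ] ℝ := (-s⁻¹) • (l ∘ₗ LinearMap.inl ℝ (Euc n) ℝ)
    have hm : ∀ y, m y = -s⁻¹ * l (y, 0) := fun y => rfl
    refine ⟨m.toAffineMap + AffineMap.const ℝ _ (e - m x), ?_, by simp⟩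
    intro v hv
    have h1 := hl (some v) (by simp [hL, hv])
    simp only at h1
    rw [hlin] at h1
    have h2 : m (intPt v - x) ≤ ω v - e := by
      rw [hm, neg_mul, neg_le, ← sub_nonneg]
      have : s⁻¹ * l (intPt v - x, 0) - -(ω v - e) = s⁻¹ * (l (intPt v - x, 0) + (ω v - e) * s) := by
        field_simp; ring
      rw [this]; positivity
    rw [map_sub] at h2
    simp
    linarith


lemma le_height_of_le_env {n : ℕ} {P : Set (Euc n)} (hP : IsLatticePolytope P)
    (ω : (Fin n → ℤ) → ℝ) (a : Euc n →ᵃ[ℝ] ℝ) (ha : ∀ x ∈ P, a x ≤ lowerEnv P ω x) :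
    ∀ v ∈ latticePts P, a (intPt v) ≤ ω v :=
  fun _ hv => (ha _ hv).trans (env_le_height hP ω hv)

lemma regCell_hull {n : ℕ} {P : Set (Euc n)} (hP : IsLatticePolytope P)
    {ω : (Fin n → ℤ) → ℝ} {F : Set (Euc n)} (hF : IsRegularCell P ω F) :
    ∃ a : Euc n →ᵃ[ℝ] ℝ, (∀ v ∈ latticePts P, a (intPt v) ≤ ω v) ∧
      F = convexHull ℝ (intPt '' {v ∈ latticePts P | a (intPt v) = ω v}) := by
  obtain ⟨_, a, ha, hFa⟩ := hF
  have ha' := le_height_of_le_env hP ω a ha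
  exact ⟨a, ha', by rw [hFa, cell_eq hP ω a ha']⟩

lemma regCell_of {n : ℕ} {P : Set (Euc n)} (hP : IsLatticePolytope P)
    {ω : (Fin n → ℤ) → ℝ} (a : Euc n →ᵃ[ℝ] ℝ) (ha : ∀ v ∈ latticePts P, a (intPt v) ≤ ω v)
    (hne : {v ∈ latticePts P | a (intPt v) = ω v}.Nonempty) :
    IsRegularCell P ω (convexHull ℝ (intPt '' {v ∈ latticePts P | a (intPt v) = ω v})) := by
  refine ⟨(hne.image _).convexHull, a, fun x hx => le_env hP ω a ha hx, ?_⟩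
  rw [cell_eq hP ω a ha]

lemma regCell_finite {n : ℕ} {P : Set (Euc n)} (hP : IsLatticePolytope P)
    (ω : (Fin n → ℤ) → ℝ) : {F | IsRegularCell P ω F}.Finite := by
  apply (((lattice_fin hP).1.powerset).image (fun T => convexHull ℝ (intPt '' T))).subset
  intro F hF
  obtain ⟨a, _, hF⟩ := regCell_hull hP hF
  exact ⟨_, fun v hv => hv.1, hF.symm⟩

lemma mem_cells {n : ℕ} {P : Set (Euc n)} (hP : IsLatticePolytope P)
    (ω : (Fin n → ℤ) → ℝ) (F : Set (Euc n)) :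
    F ∈ (regCell_finite hP ω).toFinset ↔ IsRegularCell P ω F := by
  rw [Set.Finite.mem_toFinset]; rfl

lemma regCell_lattice {n : ℕ} {P : Set (Euc n)} (hP : IsLatticePolytope P)
    {ω : (Fin n → ℤ) → ℝ} {F : Set (Euc n)} (hF : IsRegularCell P ω F) : IsLatticePolytope F := by
  obtain ⟨a, _, hF⟩ := regCell_hull hP hF
  refine ⟨((lattice_fin hP).1.subset (fun v hv => hv.1 :
    {v ∈ latticePts P | a (intPt v) = ω v} ⊆ _)).toFinset, ?_⟩
  rw [Set.Finite.coe_toFinset]; exact hF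

lemma IsLatticePolytope.isPolytope {n : ℕ} {P : Set (Euc n)} (hP : IsLatticePolytope P) :
    IsPolytope P := by
  obtain ⟨V, hV⟩ := hP
  exact ⟨V.image intPt, by rw [hV]; simp⟩

lemma aff_apply {n : ℕ} (a : Euc n →ᵃ[ℝ] ℝ) (x : Euc n) : a x = a.linear x + a 0 := by
  have := congrFun a.decomp x
  simpa using this

lemma regCell_inter {n : ℕ} {P : Set (Euc n)}
    {ω : (Fin n → ℤ) → ℝ} {F G : Set (Euc n)} (hF : IsRegularCell P ω F)
    (hG : IsRegularCell P ω G) : IsExposed ℝ F (F ∩ G) := by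
  obtain ⟨_, a, ha, hFa⟩ := hF
  obtain ⟨_, b, hb, hGb⟩ := hG
  rintro ⟨z, hzF, hzG⟩
  refine ⟨LinearMap.toContinuousLinearMap (b.linear - a.linear), ?_⟩
  have hval : ∀ x, (LinearMap.toContinuousLinearMap (b.linear - a.linear)) x
      = b x - a x - (b 0 - a 0) := by
    intro x
    rw [aff_apply a x, aff_apply b x]; simp; ring
  simp_rw [hval]
  rw [hFa] at hzF
  rw [hGb] at hzG
  ext x
  constructor
  · rintro ⟨hx, hx'⟩
    refine ⟨hx, ?_⟩
    intro y hy
    rw [hFa] at hx hy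
    rw [hGb] at hx'
    linarith [hb y hy.1, hy.2, hx.2, hx'.2]
  · rintro ⟨hx, hx'⟩
    have h1 := hx' z (by rw [hFa]; exact hzF)
    refine ⟨hx, ?_⟩
    rw [hFa] at hx
    rw [hGb]
    refine ⟨hx.1, le_antisymm (hb x hx.1) ?_⟩
    linarith [hzF.2, hzG.2, hx.2]

lemma regCell_face {n : ℕ} {P : Set (Euc n)} (hP : IsLatticePolytope P)
    {ω : (Fin n → ℤ) → ℝ} {F G : Set (Euc n)} (hF : IsRegularCell P ω F)
    (hG : IsExposed ℝ F G) (hGne : G.Nonempty) : IsRegularCell P ω G := by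
  obtain ⟨_, a, ha, hFa⟩ := hF
  obtain ⟨l, hl⟩ := hG hGne
  obtain ⟨g, hg⟩ := hGne
  have ha' := le_height_of_le_env hP ω a ha
  have hg' := hg
  rw [hl] at hg'
  set M := l g with hM
  have hev : ∀ᶠ ε : ℝ in nhdsWithin 0 (Set.Ioi 0), ∀ v ∈ latticePts P,
      a (intPt v) < ω v → a (intPt v) + ε * (l (intPt v) - M) < ω v := by
    rw [(lattice_fin hP).1.eventually_all]
    intro v hv
    by_cases h : a (intPt v) < ω v
    · have : Filter.Tendsto (fun ε : ℝ => a (intPt v) + ε * (l (intPt v) - M)) (nhds 0)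
          (nhds (a (intPt v) + 0 * (l (intPt v) - M))) := by
        apply Continuous.tendsto
          (f := fun ε : ℝ => a (intPt v) + ε * (l (intPt v) - M))
        fun_prop
      simp only [zero_mul, add_zero] at this
      filter_upwards [nhdsWithin_le_nhds (this.eventually (gt_mem_nhds h))] with ε hε _
      exact hε
    · exact Filter.Eventually.of_forall (fun _ h' => absurd h' h)
  obtain ⟨ε, hε, hε0⟩ := (hev.and self_mem_nhdsWithin).exists
  replace hε0 : 0 < ε := hε0
  let a' : Euc n →ᵃ[ℝ] ℝ := a + ε • (l.toLinearMap.toAffineMap - AffineMap.const ℝ _ M)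
  have hv' : ∀ x, a' x = a x + ε * (l x - M) := by intro x; simp [a']
  have hF_le : ∀ x ∈ F, l x ≤ M := fun x hx => hg'.2 x hx
  have hcell : ∀ v ∈ latticePts P, a (intPt v) = ω v → intPt v ∈ F := by
    intro v hv h
    rw [hFa]
    exact ⟨hv, le_antisymm (ha _ hv) ((env_le_height hP ω hv).trans h.ge)⟩
  have hle : ∀ v ∈ latticePts P, a' (intPt v) ≤ ω v := by
    intro v hv
    rw [hv']
    rcases (ha' v hv).lt_or_eq with h | h
    · exact (hε v hv h).le
    · have := hF_le _ (hcell v hv h)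
      nlinarith
  refine ⟨⟨g, hg⟩, a', fun x hx => le_env hP ω a' hle hx, ?_⟩
  apply Set.Subset.antisymm
  · intro x hx
    rw [hl] at hx
    have h1 := hx.2 g hg'.1
    have h2 := hF_le x hx.1
    have h3 : l x = M := le_antisymm h2 h1
    have h4 := hx.1
    rw [hFa] at h4
    refine ⟨h4.1, ?_⟩
    rw [hv', h3, ← h4.2]; ring
  · rw [cell_eq hP ω a' hle]
    have hFc : Convex ℝ F := by
      rw [hFa, cell_eq hP ω a ha']; exact convex_convexHull ℝ _
    have hc : Convex ℝ (F ∩ {x | l x = M}) :=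
      hFc.inter (convex_hyperplane l.toLinearMap.isLinear M)
    have hsub : convexHull ℝ (intPt '' {v ∈ latticePts P | a' (intPt v) = ω v}) ⊆
        F ∩ {x | l x = M} := by
      apply convexHull_min _ hc
      rintro _ ⟨v, ⟨hv, hve⟩, rfl⟩
      rw [hv'] at hve
      rcases (ha' v hv).lt_or_eq with h | h
      · exact absurd hve (hε v hv h).ne
      · refine ⟨hcell v hv h, ?_⟩
        have : ε * (l (intPt v) - M) = 0 := by linarith
        rcases mul_eq_zero.1 this with h' | h'
        · exact absurd h' hε0.ne'
        · exact sub_eq_zero.1 h'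
    intro x hx
    obtain ⟨h1, h2⟩ := hsub hx
    rw [hl]
    refine ⟨h1, fun y hy => ?_⟩
    have h2' : l x = M := h2
    rw [h2']; exact hF_le y hy

def regSub {n : ℕ} {P : Set (Euc n)} (hP : IsLatticePolytope P) (ω : (Fin n → ℤ) → ℝ) :
    Subdivision P where
  cells := (regCell_finite hP ω).toFinset
  nonempty_cells := by
    intro F hF; rw [mem_cells hP ω] at hF; exact hF.1
  poly := by
    intro F hF; rw [mem_cells hP ω] at hF; exact (regCell_lattice hP hF).isPolytope
  cover := by
    ext x
    simp only [mem_cells hP ω, Set.mem_iUnion, exists_prop]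
    constructor
    · rintro ⟨F, ⟨_, a, _, rfl⟩, hx⟩; exact hx.1
    · intro hx
      obtain ⟨a, ha, hax⟩ := subgrad hP ω hx
      exact ⟨{y ∈ P | a y = lowerEnv P ω y},
        ⟨⟨x, hx, hax⟩, a, fun y hy => le_env hP ω a ha hy, rfl⟩, hx, hax⟩
  inter_face := by
    intro F hF G hG; rw [mem_cells hP ω] at hF hG
    refine ⟨regCell_inter hF hG, ?_⟩
    rw [Set.inter_comm]; exact regCell_inter hG hF
  face_mem := by
    intro F hF G hG hne; rw [mem_cells hP ω] at hF ⊢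
    exact regCell_face hP hF hG hne

/-- The only consequences of the valuation axioms used below. -/
def WeakVal {n : ℕ} {G : Type*} [AddCommGroup G] (ψ : Set (Euc n) → G) : Prop :=
  ψ ∅ = 0 ∧ ∀ (P : Set (Euc n)) (hP : IsLatticePolytope P) (ω : (Fin n → ℤ) → ℝ),
    ψ P = ∑ F ∈ (regCell_finite hP ω).toFinset,
      (if F ⊆ relBoundary P then 0 else ((-1 : ℤ) ^ (pdim P - pdim F)) • ψ F)

lemma IsValuation.weak_sub {n : ℕ} {G : Type*} [AddCommGroup G] {φ₁ φ₂ : Set (Euc n) → G}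
    (h₁ : IsValuation φ₁) (h₂ : IsValuation φ₂) : WeakVal (fun P => φ₁ P - φ₂ P) := by
  refine ⟨by simp [h₁.empty, h₂.empty], ?_⟩
  intro P hP ω
  have key : ∀ φ : Set (Euc n) → G, IsValuation φ → φ P = ∑ F ∈ (regCell_finite hP ω).toFinset,
      (if F ⊆ relBoundary P then 0 else ((-1 : ℤ) ^ (pdim P - pdim F)) • φ F) := by
    intro φ h
    refine h.subdiv P hP (regSub hP ω) ?_ ⟨ω, ?_⟩
    · intro F hF
      exact regCell_lattice hP ((mem_cells hP ω _).1 hF)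
    · simp [regSub]
  beta_reduce
  rw [key φ₁ h₁, key φ₂ h₂, ← Finset.sum_sub_distrib]
  apply Finset.sum_congr rfl
  intro F _
  split_ifs
  · simp
  · rw [smul_sub]

lemma WeakVal.zero_of_cells {n : ℕ} {G : Type*} [AddCommGroup G] {ψ : Set (Euc n) → G}
    (h : WeakVal ψ) {P : Set (Euc n)} (hP : IsLatticePolytope P) (ω : (Fin n → ℤ) → ℝ)
    (hz : ∀ F, IsRegularCell P ω F → ψ F = 0) : ψ P = 0 := by
  rw [h.2 P hP ω]
  apply Finset.sum_eq_zero
  intro F hF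
  rw [hz F ((mem_cells hP ω _).1 hF)]
  simp

lemma intrinsicInterior_mono' {n : ℕ} {s t : Set (Euc n)} (hst : s ⊆ t)
    (h : affineSpan ℝ s = affineSpan ℝ t) : intrinsicInterior ℝ s ⊆ intrinsicInterior ℝ t := by
  unfold intrinsicInterior
  rw [h]
  exact Set.image_mono (interior_mono (Set.preimage_mono hst))

lemma WeakVal.eq_of_cells {n : ℕ} {G : Type*} [AddCommGroup G] {ψ : Set (Euc n) → G}
    (h : WeakVal ψ) {P D : Set (Euc n)} (hP : IsLatticePolytope P) (ω : (Fin n → ℤ) → ℝ)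
    (hD : IsRegularCell P ω D) (hsp : affineSpan ℝ D = affineSpan ℝ P)
    (hz : ∀ F, IsRegularCell P ω F → F ≠ D → ψ F = 0) : ψ P = ψ D := by
  rw [h.2 P hP ω, Finset.sum_eq_single D]
  · have hDP : D ⊆ P := by
      obtain ⟨_, a, _, rfl⟩ := hD; exact fun x hx => hx.1
    have hconv : Convex ℝ D := by
      obtain ⟨a, _, rfl⟩ := regCell_hull hP hD; exact convex_convexHull ℝ _
    have h1 : ¬ D ⊆ relBoundary P := by
      intro hsub
      obtain ⟨x, hx⟩ := Set.Nonempty.intrinsicInterior hconv hD.1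
      exact (hsub (intrinsicInterior_subset hx)).2 (intrinsicInterior_mono' hDP hsp hx)
    have h2 : pdim P = pdim D := by
      unfold pdim
      rw [← direction_affineSpan, ← direction_affineSpan, hsp]
    rw [if_neg h1, h2]; simp
  · intro F hF hne
    rw [hz F ((mem_cells hP ω _).1 hF) hne]; simp
  · intro hn
    exact absurd ((mem_cells hP ω _).2 hD) hn



/-- Affine independence over the reals of a finite family of lattice points. -/
def Indep {n : ℕ} {ι : Type*} [Fintype ι] (v : ι → Fin n → ℤ) : Prop :=
  ∀ c : ι → ℝ, ∑ i, c i = 0 → ∑ i, c i • intPt (v i) = 0 → ∀ i, c i = 0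

lemma Indep.comp {n : ℕ} {ι κ : Type*} [Fintype ι] [Fintype κ] {v : ι → Fin n → ℤ}
    (hv : Indep v) (f : κ → ι) (hf : Function.Injective f) : Indep (v ∘ f) := by
  intro c h1 h2 k
  have h0 : ∀ i ∉ Set.range f, Function.extend f c 0 i = 0 := by
    intro i hi
    rw [Function.extend_apply' _ _ _ (by simpa using hi)]; rfl
  have h := hv (Function.extend f c 0) ?_ ?_ (f k)
  · rwa [hf.extend_apply] at h
  · rw [← h1]
    symm
    apply Fintype.sum_of_injective f hf _ _ h0
    intro i; rw [hf.extend_apply]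
  · rw [← h2]
    symm
    apply Fintype.sum_of_injective f hf
    · intro i hi; rw [h0 i hi, zero_smul]
    · intro i; rw [hf.extend_apply]; rfl

lemma sq_sum_ge_one {n : ℕ} {x w : Fin n → ℤ} (h : x ≠ w) :
    (1 : ℝ) ≤ ∑ i, ((x i : ℝ) - w i) ^ 2 := by
  obtain ⟨i, hi⟩ := Function.ne_iff.1 h
  have h1 : (1 : ℤ) ≤ ∑ i, (x i - w i) ^ 2 := by
    have h2 : (x i - w i) ^ 2 ≤ ∑ i, (x i - w i) ^ 2 :=
      Finset.single_le_sum (f := fun i => (x i - w i) ^ 2) (fun j _ => sq_nonneg _) (Finset.mem_univ i)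
    have h3 : 0 < (x i - w i) ^ 2 := by
      have : x i - w i ≠ 0 := sub_ne_zero.2 hi
      positivity
    omega
  exact_mod_cast h1

lemma env_quad {n : ℕ} {P : Set (Euc n)} (hP : IsLatticePolytope P) (v₀ : Fin n → ℤ) (s : ℝ)
    (hs0 : 0 ≤ s) (hs1 : s ≤ 1) {w : Fin n → ℤ} (hw : w ∈ latticePts P) :
    lowerEnv P (fun x => 2 * ∑ i, (x i : ℝ) ^ 2 - (if x = v₀ then s else 0)) (intPt w) =
      2 * ∑ i, (w i : ℝ) ^ 2 - (if w = v₀ then s else 0) := by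
  apply le_antisymm
  · exact env_le_height hP _ hw
  · let l : Euc n →ₗ[ℝ] ℝ := ∑ i, (4 * (w i : ℝ)) • LinearMap.proj i
    have hl : ∀ x : Euc n, l x = ∑ i, 4 * (w i : ℝ) * x i := by intro x; simp [l]
    let b : Euc n →ᵃ[ℝ] ℝ := l.toAffineMap + AffineMap.const ℝ _
      (-2 * ∑ i, (w i : ℝ) ^ 2 - (if w = v₀ then s else 0))
    have hb : ∀ x : Fin n → ℤ, b (intPt x) = 2 * ∑ i, (x i : ℝ) ^ 2
        - 2 * ∑ i, ((x i : ℝ) - w i) ^ 2 - (if w = v₀ then s else 0) := by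
      intro x
      have : b (intPt x) = l (intPt x) + (-2 * ∑ i, (w i : ℝ) ^ 2 - (if w = v₀ then s else 0)) := by
        simp [b]
      rw [this, hl]
      rw [← add_sub_assoc]
      congr 1
      simp_rw [Finset.mul_sum]
      rw [← Finset.sum_add_distrib, ← Finset.sum_sub_distrib]
      apply Finset.sum_congr rfl
      intro i _
      simp only [intPt]
      ring
    have h1 := le_env hP (fun x => 2 * ∑ i, (x i : ℝ) ^ 2 - (if x = v₀ then s else 0)) b ?_ hw
    · rw [hb] at h1
      simpa using h1
    · intro x _
      rw [hb]
      by_cases hxw : x = w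
      · subst hxw; simp
      · have := sq_sum_ge_one hxw
        split_ifs <;> linarith

lemma reduce_to_simplex {n : ℕ} {G : Type*} [AddCommGroup G] {ψ : Set (Euc n) → G}
    (h : WeakVal ψ)
    (hs : ∀ (m : ℕ) (v : Fin m → Fin n → ℤ), Indep v →
      ψ (convexHull ℝ (intPt '' Set.range v)) = 0) :
    ∀ (N : ℕ) (P : Set (Euc n)), IsLatticePolytope P → (latticePts P).ncard = N → ψ P = 0 := by
  intro N
  induction N using Nat.strong_induction_on with
  | _ N ih =>
  intro P hP hN
  obtain ⟨hfin, hhull⟩ := lattice_fin hP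
  have : Fintype (latticePts P) := hfin.fintype
  by_cases hind : Indep (fun v : latticePts P => (v : Fin n → ℤ))
  · have := hs _ _ (hind.comp (Fintype.equivFin (latticePts P)).symm (Equiv.injective _))
    rw [hhull]
    convert this using 4
    ext v
    simp only [Set.mem_range, Function.comp_apply]
    constructor
    · intro hv
      exact ⟨Fintype.equivFin _ ⟨v, hv⟩, by simp⟩
    · rintro ⟨i, rfl⟩; exact Subtype.prop _
  · unfold Indep at hind
    push Not at hind
    obtain ⟨c, hc1, hc2, ⟨v₀, hv₀⟩, hc3⟩ := hind
    have hex : ∃ ω : (Fin n → ℤ) → ℝ, ¬ IsRegularCell P ω P := by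
      by_contra! hall
      have key : ∀ s : ℝ, 0 ≤ s → s ≤ 1 → ∃ a : Euc n →ᵃ[ℝ] ℝ, ∀ w ∈ latticePts P,
          a (intPt w) = 2 * ∑ i, (w i : ℝ) ^ 2 - (if w = v₀ then s else 0) := by
        intro s hs0 hs1
        obtain ⟨_, a, _, hPa⟩ := hall (fun x => 2 * ∑ i, (x i : ℝ) ^ 2 - (if x = v₀ then s else 0))
        refine ⟨a, fun w hw => ?_⟩
        have hw' : intPt w ∈ P := hw
        rw [hPa] at hw'
        rw [hw'.2, env_quad hP v₀ s hs0 hs1 hw]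
      have zero : ∀ a : Euc n →ᵃ[ℝ] ℝ, ∑ i, c i * a (intPt (i : Fin n → ℤ)) = 0 := by
        intro a
        simp_rw [aff_apply a (intPt _), mul_add, Finset.sum_add_distrib, ← Finset.sum_mul, hc1]
        have := congrArg a.linear hc2
        rw [map_sum, map_zero] at this
        simp only [map_smul, smul_eq_mul] at this
        rw [this]; simp
      obtain ⟨a, ha⟩ := key 0 le_rfl zero_le_one
      obtain ⟨b, hb⟩ := key 1 zero_le_one le_rfl
      have h1 : ∑ i, (c i * a (intPt (i : Fin n → ℤ)) - c i * b (intPt (i : Fin n → ℤ))) = 0 := by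
        rw [Finset.sum_sub_distrib, zero a, zero b, sub_zero]
      have h2 : ∀ i : latticePts P, (c i * a (intPt (i : Fin n → ℤ)) - c i * b (intPt (i : Fin n → ℤ)))
          = if i = ⟨v₀, hv₀⟩ then c i else 0 := by
        intro i
        rw [ha _ i.2, hb _ i.2]
        by_cases hi : i = ⟨v₀, hv₀⟩
        · subst hi; simp; ring
        · have : (i : Fin n → ℤ) ≠ v₀ := fun h => hi (Subtype.ext h)
          simp [hi, this]
      simp_rw [h2] at h1
      rw [Finset.sum_ite_eq' Finset.univ] at h1
      simp at h1
      exact hc3 h1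
    obtain ⟨ω, hω⟩ := hex
    apply h.zero_of_cells hP ω
    intro F hF
    have hFl := regCell_lattice hP hF
    have hFP : F ⊆ P := by
      obtain ⟨_, a, _, rfl⟩ := hF; exact fun x hx => hx.1
    refine ih _ ?_ F hFl rfl
    rw [← hN]
    apply Set.ncard_lt_ncard _ hfin
    refine ⟨fun v hv => hFP hv, fun hsub => hω ?_⟩
    have : F = P := by
      apply hFP.antisymm
      rw [hhull, (lattice_fin hFl).2]
      exact convexHull_mono (Set.image_mono hsub)
    rw [← this] at hF ⊢
    exact hF



/-- Homogenized coordinate matrix of a family of lattice points. -/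
def homMat {n : ℕ} {ι : Type*} (v : ι → Fin n → ℤ) : Matrix ι (Option (Fin n)) ℤ :=
  Matrix.of fun i o => match o with
    | none => 1
    | some k => v i k

/-- Gram determinant of the homogenized family. -/
def gramDet {n : ℕ} {ι : Type*} [Fintype ι] (v : ι → Fin n → ℤ) : ℤ :=
  (homMat v * (homMat v).transpose).det

def homMatR {n : ℕ} {ι : Type*} (v : ι → Fin n → ℤ) : Matrix ι (Option (Fin n)) ℝ :=
  (homMat v).map (Int.cast : ℤ → ℝ)

lemma gramDet_cast {n : ℕ} {ι : Type*} [Fintype ι] (v : ι → Fin n → ℤ) :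
    (gramDet v : ℝ) = (homMatR v * (homMatR v).transpose).det := by
  unfold gramDet homMatR
  have h := (Int.castRingHom ℝ).map_det (homMat v * (homMat v).transpose)
  rw [RingHom.mapMatrix_apply, Matrix.map_mul] at h
  exact h

lemma homMatR_none {n : ℕ} {ι : Type*} (v : ι → Fin n → ℤ) (i : ι) : homMatR v i none = 1 := by
  simp [homMatR, homMat]

lemma homMatR_some {n : ℕ} {ι : Type*} (v : ι → Fin n → ℤ) (i : ι) (k : Fin n) :
    homMatR v i (some k) = intPt (v i) k := by
  simp [homMatR, homMat, intPt]

lemma vecMul_homMatR {n : ℕ} {ι : Type*} [Fintype ι] (v : ι → Fin n → ℤ) (c : ι → ℝ) :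
    Matrix.vecMul c (homMatR v) = 0 ↔ ∑ i, c i = 0 ∧ ∑ i, c i • intPt (v i) = 0 := by
  constructor
  · intro h
    constructor
    · have := congrFun h none
      simpa [Matrix.vecMul, dotProduct, homMatR_none] using this
    · ext k
      have := congrFun h (some k)
      simpa [Matrix.vecMul, dotProduct, homMatR_some] using this
  · rintro ⟨h1, h2⟩
    ext o
    cases o with
    | none => simpa [Matrix.vecMul, dotProduct, homMatR_none] using h1
    | some k =>
      have := congrFun h2 k
      simpa [Matrix.vecMul, dotProduct, homMatR_some] using this

lemma indep_iff_gramDet {n : ℕ} {ι : Type*} [Fintype ι] (v : ι → Fin n → ℤ) :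
    Indep v ↔ gramDet v ≠ 0 := by
  have h0 : gramDet v ≠ 0 ↔ (homMatR v * (homMatR v).transpose).det ≠ 0 := by
    rw [← gramDet_cast]; simp
  rw [h0]
  constructor
  · intro hv hd
    obtain ⟨c, hc, hc0⟩ := Matrix.exists_vecMul_eq_zero_iff.2 hd
    apply hc
    have h1 : Matrix.vecMul c (homMatR v) = 0 := by
      rw [← dotProduct_self_eq_zero]
      have : Matrix.vecMul c (homMatR v) ⬝ᵥ Matrix.vecMul c (homMatR v) =
          Matrix.vecMul c (homMatR v * (homMatR v).transpose) ⬝ᵥ c := by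
        rw [← Matrix.vecMul_vecMul, ← Matrix.dotProduct_mulVec, Matrix.vecMul_transpose, dotProduct_comm]
      rw [this, hc0, zero_dotProduct]
    obtain ⟨h2, h3⟩ := (vecMul_homMatR v c).1 h1
    funext i
    exact hv c h2 h3 i
  · intro hd c h1 h2
    by_contra! hne
    obtain ⟨i, hi⟩ := hne
    apply hd
    apply Matrix.exists_vecMul_eq_zero_iff.1
    refine ⟨c, fun h => hi (congrFun h i), ?_⟩
    rw [← Matrix.vecMul_vecMul, (vecMul_homMatR v c).2 ⟨h1, h2⟩, Matrix.zero_vecMul]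

lemma gramDet_update {n : ℕ} {ι : Type*} [Fintype ι] (v : ι → Fin n → ℤ) (t : ι → ℝ)
    (p : Fin n → ℤ) (ht : ∑ i, t i = 1) (hp : ∑ i, t i • intPt (v i) = intPt p) (i : ι) :
    (gramDet (Function.update v i p) : ℝ) = (t i) ^ 2 * gramDet v := by
  have hE : homMatR (Function.update v i p) = (Matrix.updateRow 1 i t) * homMatR v := by
    ext j o
    rw [← Matrix.row_apply (Matrix.updateRow 1 i t * homMatR v)]
    by_cases hj : j = i
    · subst hj
      rw [Matrix.row_apply, Matrix.mul_apply]
      simp only [Matrix.updateRow_self]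
      cases o with
      | none => simp [homMatR_none, ht]
      | some k =>
        have := congrFun hp k
        simp only [homMatR_some, Function.update_self]
        rw [← this]
        simp
    · rw [Matrix.row_apply, Matrix.mul_apply]
      simp only [Matrix.updateRow_ne hj]
      cases o with
      | none => simp [homMatR_none, Matrix.one_apply]
      | some k => simp [homMatR_some, hj, Matrix.one_apply]
  have hdet : (Matrix.updateRow (1 : Matrix ι ι ℝ) i t).det = t i := by
    rw [← Matrix.cramer_transpose_apply, Matrix.transpose_one, Matrix.cramer_one]; rfl
  rw [gramDet_cast, gramDet_cast, hE, Matrix.transpose_mul]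
  have : Matrix.updateRow 1 i t * homMatR v * ((homMatR v).transpose * (Matrix.updateRow 1 i t).transpose)
      = Matrix.updateRow 1 i t * (homMatR v * (homMatR v).transpose) * (Matrix.updateRow 1 i t).transpose := by
    simp only [Matrix.mul_assoc]
  rw [this, Matrix.det_mul, Matrix.det_mul, Matrix.det_transpose, hdet]
  ring

/-- Every lattice point of the affine span is an integral affine combination. -/
def Saturated {n : ℕ} {ι : Type*} [Fintype ι] (v : ι → Fin n → ℤ) : Prop :=
  ∀ (t : ι → ℝ) (p : Fin n → ℤ), ∑ i, t i = 1 → ∑ i, t i • intPt (v i) = intPt p →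
    ∀ i, ∃ z : ℤ, t i = z

lemma intPt_sum {n : ℕ} {ι : Type*} (s : Finset ι) (z : ι → ℤ) (v : ι → Fin n → ℤ) :
    intPt (∑ i ∈ s, z i • v i) = ∑ i ∈ s, (z i : ℝ) • intPt (v i) := by
  ext k; simp [intPt]

lemma intPt_injective {n : ℕ} : Function.Injective (intPt : (Fin n → ℤ) → Euc n) := by
  intro x y h
  ext k
  have := congrFun h k
  simpa [intPt] using this

lemma intPt_add {n : ℕ} (x y : Fin n → ℤ) : intPt (x + y) = intPt x + intPt y := by
  ext k; simp [intPt]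

lemma intPt_sub {n : ℕ} (x y : Fin n → ℤ) : intPt (x - y) = intPt x - intPt y := by
  ext k; simp [intPt]

lemma exists_small {n : ℕ} {ι : Type*} [Fintype ι] (v : ι → Fin n → ℤ) (h : ¬ Saturated v) :
    ∃ (t : ι → ℝ) (p : Fin n → ℤ), ∑ i, t i = 1 ∧ ∑ i, t i • intPt (v i) = intPt p ∧
      ∀ i, |t i| < 1 := by
  unfold Saturated at h
  push Not at h
  obtain ⟨t, p, ht, hp, i₀, hi₀⟩ := h
  set s : ℤ := 1 - ∑ i, ⌊t i⌋ with hs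
  have hsum : ∑ i, Int.fract (t i) = (s : ℝ) := by
    rw [hs]; push_cast
    rw [← ht, ← Finset.sum_sub_distrib]; rfl
  have hf0 : 0 < Int.fract (t i₀) := by
    rcases (Int.fract_nonneg (t i₀)).lt_or_eq with h | h
    · exact h
    · exfalso
      apply hi₀ ⌊t i₀⌋
      have := Int.floor_add_fract (t i₀)
      linarith
  have hspos : 0 < s := by
    have : (0 : ℝ) < s := by
      rw [← hsum]
      exact Finset.sum_pos' (fun i _ => Int.fract_nonneg _) ⟨i₀, Finset.mem_univ _, hf0⟩
    exact_mod_cast this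
  set S := Finset.univ.filter (fun i => 0 < Int.fract (t i)) with hS
  have hcard : s ≤ S.card := by
    have : (s : ℝ) ≤ S.card := by
      rw [← hsum]
      calc ∑ i, Int.fract (t i) = ∑ i ∈ S, Int.fract (t i) := by
            symm
            apply Finset.sum_subset (Finset.subset_univ _)
            intro i _ hi
            have h1 : ¬ 0 < Int.fract (t i) := by simpa [hS] using hi
            exact le_antisymm (not_lt.1 h1) (Int.fract_nonneg _)
        _ ≤ ∑ i ∈ S, (1 : ℝ) := Finset.sum_le_sum (fun i _ => (Int.fract_lt_one _).le)
        _ = S.card := by simp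
    exact_mod_cast this
  obtain ⟨S', hS', hS'card⟩ := Finset.exists_subset_card_eq (s := S) (n := (s - 1).toNat) (by omega)
  let z : ι → ℤ := fun i => ⌊t i⌋ + if i ∈ S' then 1 else 0
  refine ⟨fun i => t i - z i, p - ∑ i, z i • v i, ?_, ?_, ?_⟩
  · rw [Finset.sum_sub_distrib, ht]
    have : ∑ i, z i = 0 := by
      simp only [z, Finset.sum_add_distrib]
      rw [Finset.sum_ite_mem]
      simp [hS'card]
      omega
    have h2 : ∑ i, (z i : ℝ) = 0 := by exact_mod_cast this
    rw [h2, sub_zero]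
  · rw [intPt_sub, intPt_sum, ← hp, ← Finset.sum_sub_distrib]
    simp_rw [sub_smul]
  · intro i
    have h1 := Int.floor_add_fract (t i)
    have h2 := Int.fract_lt_one (t i)
    have h3 := Int.fract_nonneg (t i)
    simp only [z]
    by_cases hi : i ∈ S'
    · have h4 : 0 < Int.fract (t i) := by
        have := hS' hi
        simpa [hS] using this
      rw [if_pos hi, abs_lt]; push_cast
      constructor <;> linarith
    · rw [if_neg hi, abs_lt]; push_cast
      constructor <;> linarith


lemma cons_weights {n k : ℕ} (v : Fin (k + 1) → Fin n → ℤ) (r : ℝ) (c : Fin k → ℝ) :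
    ∑ i, (Fin.cons (r - ∑ j, c j) c : Fin (k + 1) → ℝ) i = r ∧
    ∑ i, (Fin.cons (r - ∑ j, c j) c : Fin (k + 1) → ℝ) i • intPt (v i) =
      r • intPt (v 0) + ∑ j, c j • intPt (v j.succ - v 0) := by
  constructor
  · rw [Fin.sum_univ_succ]; simp
  · rw [Fin.sum_univ_succ]
    simp only [Fin.cons_zero, Fin.cons_succ, intPt_sub, smul_sub, Finset.sum_sub_distrib, sub_smul,
      Finset.sum_smul]
    abel

lemma unimod_of_saturated {n k : ℕ} (v : Fin (k + 1) → Fin n → ℤ) (hv : Indep v)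
    (hsat : Saturated v) : IsUnimodularSimplex (convexHull ℝ (intPt '' Set.range v)) := by
  let d : Fin k → Fin n → ℤ := fun j => v j.succ - v 0
  have hli : LinearIndependent ℤ d := by
    rw [Fintype.linearIndependent_iff]
    intro g hg j
    have h1 := congrArg intPt hg
    rw [intPt_sum] at h1
    have h0 : intPt (0 : Fin n → ℤ) = 0 := by ext; simp [intPt]
    rw [h0] at h1
    obtain ⟨h2, h3⟩ := cons_weights v 0 (fun j => (g j : ℝ))
    have h4 := hv _ h2 (by rw [h3, zero_smul, zero_add]; exact h1) j.succ
    simpa using h4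
  let W := Submodule.span ℤ (Set.range d)
  have hsatW : ∀ (r : ℤ) (x : Fin n → ℤ), r ≠ 0 → r • x ∈ W → x ∈ W := by
    intro r x hr hx
    obtain ⟨g, hg⟩ := (Submodule.mem_span_range_iff_exists_fun ℤ).1 hx
    have h1 := congrArg intPt hg
    rw [intPt_sum] at h1
    have hrx : intPt (r • x) = (r : ℝ) • intPt x := by ext; simp [intPt]
    rw [hrx] at h1
    have hr' : (r : ℝ) ≠ 0 := by exact_mod_cast hr
    have h5 : ∑ j, ((g j : ℝ) / r) • intPt (d j) = intPt x := by
      simp_rw [div_eq_inv_mul, mul_smul, ← Finset.smul_sum]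
      rw [h1, smul_smul, inv_mul_cancel₀ hr', one_smul]
    obtain ⟨h2, h3⟩ := cons_weights v 1 (fun j => (g j : ℝ) / r)
    have h4 := hsat _ (v 0 + x) h2 (by rw [h3, intPt_add, one_smul, ← h5])
    have h6 : ∀ j, ∃ z : ℤ, (g j : ℝ) / r = z := fun j => by simpa using h4 j.succ
    choose z hz using h6
    apply (Submodule.mem_span_range_iff_exists_fun ℤ).2
    refine ⟨z, intPt_injective ?_⟩
    rw [intPt_sum, ← h5]
    simp_rw [hz]
  have htf : Module.IsTorsionFree ℤ ((Fin n → ℤ) ⧸ W) := by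
    constructor
    intro r hr a b hab
    have hr0 : r ≠ 0 := hr.ne_zero
    induction a using Submodule.Quotient.induction_on with
    | _ a =>
    induction b using Submodule.Quotient.induction_on with
    | _ b =>
    rw [Submodule.Quotient.eq]
    apply hsatW r _ hr0
    rw [smul_sub, ← Submodule.Quotient.eq]
    exact hab
  have hfree : Module.Free ℤ ((Fin n → ℤ) ⧸ W) := Module.free_of_finite_type_torsion_free'
  let bW : Module.Basis (Fin k) ℤ W := Module.Basis.span hli
  let bQ := Module.finBasis ℤ ((Fin n → ℤ) ⧸ W)
  let b₀ := bW.sumQuot bQ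
  have hcard : k + Module.finrank ℤ ((Fin n → ℤ) ⧸ W) = n := by
    have := Module.finrank_eq_card_basis b₀
    simpa using this.symm
  let e := finSumFinEquiv.trans (finCongr hcard)
  let b := b₀.reindex e
  have hkn : k ≤ n := by omega
  have hb : ∀ j : Fin k, b ⟨j, by omega⟩ = d j := by
    intro j
    have he : e (Sum.inl j) = ⟨j, by omega⟩ := by ext; simp [e]
    rw [← he]
    simp only [b, Module.Basis.reindex_apply, Equiv.symm_apply_apply, b₀, Module.Basis.sumQuot_inl]
    exact congrArg Subtype.val (Module.Basis.span_apply hli j)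
  let A : Matrix (Fin n) (Fin n) ℤ := (Pi.basisFun ℤ (Fin n)).toMatrix b
  have hA : IsUnit A.det := by
    have := (Pi.basisFun ℤ (Fin n)).invertibleToMatrix b
    exact Matrix.isUnit_det_of_invertible A
  have hAij : ∀ i j, A i j = b j i := by
    intro i j; simp [A, Module.Basis.toMatrix_apply]
  refine ⟨k, hkn, A, hA, v 0, ?_⟩
  let U : Euc n →ᵃ[ℝ] Euc n := (Matrix.mulVecLin (A.map (Int.cast : ℤ → ℝ))).toAffineMap +
    AffineMap.const ℝ _ (intPt (v 0))
  have hU : (unimodMap A (v 0) : Euc n → Euc n) = U := by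
    ext x; simp [unimodMap, U]
  rw [hU, stdSimplexSet, AffineMap.image_convexHull, ← hU]
  congr 1
  have hzero : unimodMap A (v 0) 0 = intPt (v 0) := by simp [unimodMap]
  have hej : ∀ j : Fin k, unimodMap A (v 0)
      (fun i : Fin n => if (i : ℕ) = (j : ℕ) then (1 : ℝ) else 0) = intPt (v j.succ) := by
    intro j
    have h1 : (fun i : Fin n => if (i : ℕ) = (j : ℕ) then (1 : ℝ) else 0)
        = Pi.single (⟨j, by omega⟩ : Fin n) 1 := by
      ext i
      rw [Pi.single_apply]
      simp [Fin.ext_iff]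
    rw [h1]
    ext i
    simp only [unimodMap, Matrix.mulVec_single_one, Pi.add_apply, Matrix.col_apply, Matrix.map_apply]
    rw [hAij, hb]
    simp [intPt, d]
  rw [Set.image_insert_eq, hzero, ← Set.range_comp, ← Set.range_comp]
  have hfun : (unimodMap A (v 0) ∘ fun (j : Fin k) (i : Fin n) =>
      if (i : ℕ) = (j : ℕ) then (1 : ℝ) else 0) = fun j => intPt (v j.succ) := funext hej
  rw [hfun]
  ext y
  simp only [Set.mem_range, Set.mem_insert_iff, Function.comp_apply, Fin.exists_fin_succ, eq_comm]

lemma sub_simplex {n m : ℕ} {G : Type*} [AddCommGroup G] {ψ : Set (Euc n) → G}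
    (ihm : ∀ m' < m, ∀ v : Fin m' → Fin n → ℤ, Indep v →
      ψ (convexHull ℝ (intPt '' Set.range v)) = 0)
    (v : Fin m → Fin n → ℤ) (hv : Indep v) (T : Set (Fin n → ℤ)) (hT : T ⊆ Set.range v) :
    T = Set.range v ∨ ψ (convexHull ℝ (intPt '' T)) = 0 := by
  by_cases hall : ∀ i, v i ∈ T
  · left
    apply hT.antisymm
    rintro _ ⟨i, rfl⟩; exact hall i
  · right
    push Not at hall
    obtain ⟨i₀, hi₀⟩ := hall
    have hlt : Fintype.card {i // v i ∈ T} < m := by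
      have := Fintype.card_subtype_lt (p := fun i => v i ∈ T) hi₀
      simpa using this
    have h1 := ihm _ hlt _ (hv.comp (fun i => ((Fintype.equivFin {i // v i ∈ T}).symm i : Fin m))
      (fun i j hij => (Equiv.injective _) (Subtype.ext hij)))
    convert h1 using 4
    ext w
    constructor
    · intro hw
      obtain ⟨i, rfl⟩ := hT hw
      exact ⟨Fintype.equivFin _ ⟨i, hw⟩, by simp⟩
    · rintro ⟨i, rfl⟩
      exact ((Fintype.equivFin {i // v i ∈ T}).symm i).2

lemma simplex_zero {n : ℕ} {G : Type*} [AddCommGroup G] {ψ : Set (Euc n) → G}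
    (h : WeakVal ψ) (hu : ∀ P, IsUnimodularSimplex P → ψ P = 0) :
    ∀ (m : ℕ) (v : Fin m → Fin n → ℤ), Indep v →
      ψ (convexHull ℝ (intPt '' Set.range v)) = 0 := by
  intro m
  induction m using Nat.strong_induction_on with
  | _ m ihm =>
  suffices H : ∀ (N : ℕ) (v : Fin m → Fin n → ℤ), Indep v → (gramDet v).natAbs = N →
      ψ (convexHull ℝ (intPt '' Set.range v)) = 0 from fun v hv => H _ v hv rfl
  intro N
  induction N using Nat.strong_induction_on with
  | _ N ihN =>
  intro v hv hN
  rcases Nat.eq_zero_or_pos m with hm | hm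
  · subst hm
    have : Set.range v = ∅ := Set.range_eq_empty v
    rw [this, Set.image_empty, convexHull_empty]; exact h.1
  by_cases hsat : Saturated v
  · obtain ⟨k, rfl⟩ : ∃ k, m = k + 1 := ⟨m - 1, by omega⟩
    exact hu _ (unimod_of_saturated v hv hsat)
  obtain ⟨t, p, ht, hp, htlt⟩ := exists_small v hsat
  -- the new point is not one of the vertices
  have hpv : p ∉ Set.range v := by
    rintro ⟨j, rfl⟩
    have h1 := hv (fun i => t i - if i = j then 1 else 0)
      (by rw [Finset.sum_sub_distrib, ht]; simp)
      (by simp_rw [sub_smul, Finset.sum_sub_distrib, hp]; simp) j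
    have h2 := htlt j
    have h3 : t j = 1 := by simpa [sub_eq_zero] using h1
    rw [h3] at h2; simp at h2
  set Q := convexHull ℝ (intPt '' (insert p (Set.range v))) with hQ
  have hQl : IsLatticePolytope Q := ⟨insert p (Finset.univ.image v), by rw [hQ]; simp⟩
  have hpQ : p ∈ latticePts Q := subset_convexHull ℝ _ ⟨p, by simp, rfl⟩
  have hvQ : ∀ i, v i ∈ latticePts Q := fun i => subset_convexHull ℝ _ ⟨v i, by simp, rfl⟩
  let om : ℝ → (Fin n → ℤ) → ℝ := fun s w => if w = p then s else if w ∈ Set.range v then 0 else 2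
  have om_p : ∀ s, om s p = s := fun s => by simp [om]
  have om_v : ∀ s i, om s (v i) = 0 := fun s i => by
    have : v i ≠ p := fun h => hpv ⟨i, h⟩
    simp [om, this]
  have om_o : ∀ s w, w ∉ insert p (Set.range v) → om s w = 2 := fun s w hw => by
    rw [Set.mem_insert_iff, not_or] at hw
    simp only [om]
    rw [if_neg hw.1, if_neg hw.2]
  have a_p : ∀ a : Euc n →ᵃ[ℝ] ℝ, a (intPt p) = ∑ i, t i * a (intPt (v i)) := by
    intro a; rw [← hp, aff_sum a _ t _ ht]
  -- structure of the cells
  have hcells : ∀ s : ℝ, s ≤ 1 → s ≠ 0 → ∀ a : Euc n →ᵃ[ℝ] ℝ,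
      (∀ w ∈ latticePts Q, a (intPt w) ≤ om s w) →
      {w ∈ latticePts Q | a (intPt w) = om s w} = Set.range v ∨
      ψ (convexHull ℝ (intPt '' {w ∈ latticePts Q | a (intPt w) = om s w})) = 0 := by
    intro s hs1 hs0 a ha
    set T := {w ∈ latticePts Q | a (intPt w) = om s w} with hT
    have hTsub : T ⊆ insert p (Set.range v) := by
      intro w hw
      by_contra hcon
      have h1 : Q ⊆ a ⁻¹' Set.Iic 1 := by
        apply convexHull_min
        · rintro _ ⟨x, hx, rfl⟩
          rcases hx with rfl | ⟨i, rfl⟩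
          · have := ha _ hpQ
            rw [om_p] at this
            exact this.trans hs1
          · have := ha _ (hvQ i)
            rw [om_v] at this
            exact this.trans zero_le_one
        · exact (convex_Iic (1 : ℝ)).affine_preimage a
      have h2 : a (intPt w) ≤ 1 := h1 hw.1
      have h3 := hw.2
      rw [om_o s w hcon] at h3
      linarith
    by_cases hpT : p ∈ T
    · right
      have hex : ∃ i, t i ≠ 0 ∧ v i ∉ T := by
        by_contra! hcon
        apply hs0
        have h1 := hpT.2
        rw [om_p, a_p] at h1
        rw [← h1]
        apply Finset.sum_eq_zero
        intro i _
        by_cases hti : t i = 0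
        · rw [hti, zero_mul]
        · have := (hcon i hti).2
          rw [om_v] at this
          rw [this, mul_zero]
      obtain ⟨i, hti, hiT⟩ := hex
      have hg : (gramDet (Function.update v i p) : ℝ) = t i ^ 2 * gramDet v := by
        convert gramDet_update v t p ht hp i
      have hg0 : gramDet v ≠ 0 := (indep_iff_gramDet v).1 hv
      have hg0' : (gramDet v : ℝ) ≠ 0 := by exact_mod_cast hg0
      have hvi : Indep (Function.update v i p) := by
        rw [indep_iff_gramDet]
        have : (gramDet (Function.update v i p) : ℝ) ≠ 0 := by
          rw [hg]; positivity
        exact_mod_cast this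
      have hTr : T ⊆ Set.range (Function.update v i p) := by
        intro w hw
        rcases hTsub hw with rfl | ⟨j, rfl⟩
        · exact ⟨i, by simp⟩
        · refine ⟨j, ?_⟩
          rw [Function.update_of_ne]
          rintro rfl
          exact hiT hw
      rcases sub_simplex ihm _ hvi T hTr with hTe | hz
      · rw [hTe]
        refine ihN _ ?_ _ hvi rfl
        rw [← hN]
        have hlt : ((gramDet (Function.update v i p)).natAbs : ℝ) < ((gramDet v).natAbs : ℝ) := by
          rw [Nat.cast_natAbs, Nat.cast_natAbs, Int.cast_abs, Int.cast_abs, hg, abs_mul]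
          have h1 : |t i ^ 2| < 1 := by
            rw [abs_pow]
            exact pow_lt_one₀ (abs_nonneg _) (htlt i) two_ne_zero
          have h2 : 0 < |(gramDet v : ℝ)| := abs_pos.2 hg0'
          nlinarith
        exact_mod_cast hlt
      · exact hz
    · apply sub_simplex ihm v hv T
      intro w hw
      rcases hTsub hw with rfl | h'
      · exact absurd hw hpT
      · exact h'
  have hQ0 : ψ Q = 0 := by
    apply h.zero_of_cells hQl (om (-1))
    intro F hF
    obtain ⟨a, ha, rfl⟩ := regCell_hull hQl hF
    rcases hcells (-1) (by norm_num) (by norm_num) a ha with hT | hz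
    · exfalso
      have h0 : ∀ i, a (intPt (v i)) = 0 := by
        intro i
        have : v i ∈ {w ∈ latticePts Q | a (intPt w) = om (-1) w} := by rw [hT]; exact ⟨i, rfl⟩
        have h' := this.2
        rwa [om_v] at h'
      have h1 := ha p hpQ
      rw [om_p, a_p] at h1
      simp only [h0, mul_zero, Finset.sum_const_zero] at h1
      linarith
    · exact hz
  have hset : {w ∈ latticePts Q | (0 : Euc n →ᵃ[ℝ] ℝ) (intPt w) = om 1 w} = Set.range v := by
    ext w
    constructor
    · rintro ⟨_, hw⟩
      by_contra hcon
      have hz : (0 : ℝ) = om 1 w := hw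
      by_cases hwp : w = p
      · rw [hwp, om_p] at hz; norm_num at hz
      · rw [om_o 1 w (by simp only [Set.mem_insert_iff, not_or]; exact ⟨hwp, hcon⟩)] at hz
        norm_num at hz
    · rintro ⟨i, rfl⟩
      exact ⟨hvQ i, by rw [om_v]; rfl⟩
  have hcell : IsRegularCell Q (om 1) (convexHull ℝ (intPt '' Set.range v)) := by
    rw [← hset]
    apply regCell_of hQl
    · intro w _
      change (0 : ℝ) ≤ om 1 w
      simp only [om]
      split_ifs <;> norm_num
    · rw [hset]; exact ⟨v ⟨0, hm⟩, ⟨0, hm⟩, rfl⟩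
  rw [← h.eq_of_cells hQl (om 1) hcell ?_ ?_, hQ0]
  · rw [hQ, affineSpan_convexHull, affineSpan_convexHull, Set.image_insert_eq]
    symm
    apply affineSpan_insert_eq_affineSpan
    have h1 := affineCombination_mem_affineSpan (s := Finset.univ) (w := t) ht (fun i => intPt (v i))
    rw [Finset.affineCombination_eq_linear_combination _ _ _ ht, hp] at h1
    rw [← Set.range_comp]
    exact h1
  · intro F hF hne
    obtain ⟨a, ha, rfl⟩ := regCell_hull hQl hF
    rcases hcells 1 le_rfl one_ne_zero a ha with hT | hz
    · exact absurd (by rw [hT]) hne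
    · exact hz

theorem statement4 {n : ℕ} {G : Type*} [AddCommGroup G] (φ₁ φ₂ : Set (Euc n) → G)
    (h₁ : IsValuation φ₁) (h₂ : IsValuation φ₂)
    (hagree : ∀ P : Set (Euc n), IsUnimodularSimplex P → φ₁ P = φ₂ P) :
    ∀ P : Set (Euc n), IsLatticePolytope P → φ₁ P = φ₂ P := by
  intro P hP
  have hw := h₁.weak_sub h₂
  have hz := reduce_to_simplex hw
    (simplex_zero hw (fun P hP => by rw [hagree P hP, sub_self])) _ P hP rfl
  exact sub_eq_zero.1 hz
end
end
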